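/- Let n, m, l be positive integers with l < n. Let η be a C² map defined on an open neighborhood of the unit sphere S^n in ℝ^{n+1} with values in ℝ^{m+1} such that: (i) the rank of the differential dη_x is at most l for every x ∈ S^n; (ii) the image N = η(S^n) admits a number ε₀ > 0 and a continuous retraction ρ from the open ε₀-neighborhood U = {y ∈ ℝ^{m+1} : dist(y,N) < ε₀} onto N with ρ(y) = y for all y ∈ N (both (i) and (ii) hold automatically when N is a compact embedded C² submanifold of ℝ^{m+1} of dimension l); and (iii) the restriction η|_{S^n} : S^n → N is not null-homotopic as a map into N. Then there exists R_η > 0 such that for every R ≥ R_η there is no solution of the Dirichlet problem for the minimal surface system on the open unit ball Ω = D^{n+1} ⊂ ℝ^{n+1} with boundary data R·η|_{S^n}. -/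

import Mathlib

open MeasureTheory

/-- The induced metric `g_{ij} = δ_{ij} + Σ_α ∂_i F^α ∂_j F^α` of the graph of `F`
(using the a.e.-defined total `fderiv`). -/
noncomputable def mssMetric {n m : ℕ}
    (F : EuclideanSpace ℝ (Fin (n+1)) → EuclideanSpace ℝ (Fin (m+1)))
    (x : EuclideanSpace ℝ (Fin (n+1))) : Matrix (Fin (n+1)) (Fin (n+1)) ℝ :=
  fun i j => (if i = j then (1:ℝ) else 0) +
    ∑ α : Fin (m+1),
      fderiv ℝ F x (EuclideanSpace.single i 1) α * fderiv ℝ F x (EuclideanSpace.single j 1) α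

/-- `F` is a solution of the Dirichlet problem for the minimal surface system on `Ω`
with boundary data `f`: continuous on `closure Ω`, Lipschitz on `Ω`, equal to `f` on `∂Ω`,
and weakly satisfying the minimal surface system. -/
def IsMSSolution (n m : ℕ) (Ω : Set (EuclideanSpace ℝ (Fin (n+1))))
    (f F : EuclideanSpace ℝ (Fin (n+1)) → EuclideanSpace ℝ (Fin (m+1))) : Prop :=
  ContinuousOn F (closure Ω) ∧
  (∃ K : NNReal, LipschitzOnWith K F Ω) ∧
  (∀ x ∈ frontier Ω, F x = f x) ∧
  (∀ φ : EuclideanSpace ℝ (Fin (n+1)) → ℝ, ContDiff ℝ (⊤ : ℕ∞) φ → HasCompactSupport φ →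
     tsupport φ ⊆ Ω →
     (∀ j : Fin (n+1),
        ∫ x in Ω, (∑ i : Fin (n+1),
          Real.sqrt (mssMetric F x).det * (mssMetric F x)⁻¹ i j *
            fderiv ℝ φ x (EuclideanSpace.single i 1)) = 0) ∧
     (∀ α : Fin (m+1),
        ∫ x in Ω, (∑ i : Fin (n+1), ∑ j : Fin (n+1),
          Real.sqrt (mssMetric F x).det * (mssMetric F x)⁻¹ i j *
            fderiv ℝ F x (EuclideanSpace.single j 1) α *
            fderiv ℝ φ x (EuclideanSpace.single i 1)) = 0))

section LinAlg
open Matrix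

/-- Determinant of a rank two perturbation. -/
lemma det_add_vecMulVec_add_vecMulVec {ι : Type*} [Fintype ι] [DecidableEq ι]
    (h : Matrix ι ι ℝ) (hh : h.det ≠ 0) (p a b : ι → ℝ) :
    (h + vecMulVec p b + vecMulVec a p).det =
      h.det * ((1 + b ⬝ᵥ h⁻¹ *ᵥ p) * (1 + p ⬝ᵥ h⁻¹ *ᵥ a) -
        (b ⬝ᵥ h⁻¹ *ᵥ a) * (p ⬝ᵥ h⁻¹ *ᵥ p)) := by
  set U : Matrix ι (Fin 2) ℝ := (Matrix.of ![p, a])ᵀ with hU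
  set W : Matrix (Fin 2) ι ℝ := Matrix.of ![b, p] with hW
  have e1 : h + vecMulVec p b + vecMulVec a p = h * (1 + (h⁻¹ * U) * W) := by
    rw [mul_add, mul_one, ← Matrix.mul_assoc, ← Matrix.mul_assoc,
      mul_nonsing_inv h (isUnit_iff_ne_zero.mpr hh),
      Matrix.one_mul, add_assoc]
    congr 1
    ext i j
    simp [vecMulVec_apply, Matrix.mul_apply, hU, hW]
  have e2 : ∀ i j, ((1 : Matrix (Fin 2) (Fin 2) ℝ) + W * (h⁻¹ * U)) i j = (if i = j then 1 else 0) +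
      (![b, p] i) ⬝ᵥ h⁻¹ *ᵥ (![p, a] j) := by
    intro i j
    rw [Matrix.add_apply, Matrix.one_apply, Matrix.mul_apply]
    rfl
  rw [e1, det_mul, det_one_add_mul_comm, det_fin_two, e2, e2, e2, e2]
  simp

lemma dotProduct_adjugate_eq {ι : Type*} [Fintype ι] [DecidableEq ι]
    (g : Matrix ι ι ℝ) (hg : g.det ≠ 0) (p q : ι → ℝ) :
    p ⬝ᵥ g.adjugate *ᵥ q = g.det * (p ⬝ᵥ g⁻¹ *ᵥ q) := by
  rw [Matrix.inv_def, smul_mulVec, dotProduct_smul, Ring.inverse_eq_inv', smul_eq_mul,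
    mul_inv_cancel_left₀ hg]

lemma dotProduct_adjugate_add_vecMulVec {ι : Type*} [Fintype ι] [DecidableEq ι]
    (h : Matrix ι ι ℝ) (hh : h.det ≠ 0) (p a b : ι → ℝ)
    (hg : (h + vecMulVec p b + vecMulVec a p).det ≠ 0) :
    p ⬝ᵥ (h + vecMulVec p b + vecMulVec a p).adjugate *ᵥ p = p ⬝ᵥ h.adjugate *ᵥ p := by
  have key : ∀ g : Matrix ι ι ℝ, g.det ≠ 0 →
      p ⬝ᵥ g.adjugate *ᵥ p = (g + vecMulVec p p).det - g.det := by
    intro g hg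
    have := det_add_vecMulVec_add_vecMulVec g hg p 0 p
    simp only [zero_vecMulVec, mulVec_zero, dotProduct_zero, add_zero] at this
    rw [dotProduct_adjugate_eq g hg, this]; ring
  rw [key _ hg, dotProduct_adjugate_eq h hh]
  have e : h + vecMulVec p b + vecMulVec a p + vecMulVec p p =
      h + vecMulVec p (b + p) + vecMulVec a p := by
    rw [vecMulVec_add]; abel
  rw [e, det_add_vecMulVec_add_vecMulVec h hh, det_add_vecMulVec_add_vecMulVec h hh,
    add_dotProduct, add_dotProduct]
  ring

lemma isHermitian_transpose_mul {ι κ : Type*} [Fintype κ]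
    (M : Matrix κ ι ℝ) : (Mᵀ * M).IsHermitian := by
  simpa using isHermitian_conjTranspose_mul_self M

lemma posSemidef_transpose_mul {ι κ : Type*} [Fintype ι] [Fintype κ]
    (M : Matrix κ ι ℝ) : (Mᵀ * M).PosSemidef := by
  simpa using posSemidef_conjTranspose_mul_self M

lemma posDef_one_add {ι κ : Type*} [Fintype ι] [DecidableEq ι] [Fintype κ]
    (M : Matrix κ ι ℝ) : (1 + Mᵀ * M).PosDef :=
  PosDef.one.add_posSemidef (posSemidef_transpose_mul M)

lemma det_one_add_le {ι κ : Type*} [Fintype ι] [DecidableEq ι] [Fintype κ] [DecidableEq κ]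
    (M : Matrix κ ι ℝ) (l : ℕ) (hl : M.rank ≤ l) :
    (1 + Mᵀ * M).det ≤ (1 + (Mᵀ * M).trace) ^ l := by
  have hH := isHermitian_transpose_mul M
  have hnn := (posSemidef_transpose_mul M).eigenvalues_nonneg
  have htr : (Mᵀ * M).trace = ∑ i, hH.eigenvalues i := by simpa using hH.trace_eq_sum_eigenvalues
  have hdet : (1 + Mᵀ * M).det = ∏ i, (1 + hH.eigenvalues i) := by
    have h1 : (-(1:ℝ)) ^ Fintype.card ι * (1 + Mᵀ * M).det = (Mᵀ * M).charpoly.eval (-1) := by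
      rw [Matrix.eval_charpoly, ← Matrix.det_neg]
      congr 1
      ext i j
      by_cases hij : i = j
      · simp [Matrix.scalar_apply, hij]; ring
      · simp [Matrix.scalar_apply, hij]
    rw [hH.charpoly_eq, Polynomial.eval_prod] at h1
    have h2 : ∏ i, Polynomial.eval (-1) (Polynomial.X - Polynomial.C (hH.eigenvalues i : ℝ)) =
        (-(1:ℝ)) ^ Fintype.card ι * ∏ i, (1 + hH.eigenvalues i) := by
      rw [Fintype.card, ← Finset.prod_const, ← Finset.prod_mul_distrib]
      refine Finset.prod_congr rfl fun i _ => ?_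
      simp; ring
    have h3 : (-(1:ℝ)) ^ Fintype.card ι ≠ 0 := by positivity
    exact mul_left_cancel₀ h3 (h1.trans h2)
  have hcard : (Finset.univ.filter fun i => hH.eigenvalues i ≠ 0).card ≤ l := by
    rw [← Fintype.card_subtype, ← hH.rank_eq_card_non_zero_eigs, rank_transpose_mul_self]
    exact hl
  have htr0 : 0 ≤ (Mᵀ * M).trace := by rw [htr]; exact Finset.sum_nonneg fun i _ => hnn i
  rw [hdet]
  calc ∏ i, (1 + hH.eigenvalues i)
      = ∏ i ∈ Finset.univ.filter (fun i => hH.eigenvalues i ≠ 0), (1 + hH.eigenvalues i) := by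
        rw [Finset.prod_filter]
        refine Finset.prod_congr rfl fun i _ => ?_
        split_ifs with h
        · rfl
        · push Not at h; simp [h]
    _ ≤ ∏ i ∈ Finset.univ.filter (fun i => hH.eigenvalues i ≠ 0), (1 + (Mᵀ * M).trace) := by
        refine Finset.prod_le_prod (fun i _ => by have := hnn i; positivity) fun i _ => ?_
        rw [htr]
        have := Finset.single_le_sum (fun j _ => hnn j) (Finset.mem_univ i)
        linarith
    _ ≤ (1 + (Mᵀ * M).trace) ^ l := by
        rw [Finset.prod_const]
        exact pow_le_pow_right₀ (by linarith) hcard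

/-- With `q = y + Mᵀ z`, the Cauchy-Schwarz inequality for the induced metric. -/
lemma sq_dotProduct_inv_le {ι κ : Type*} [Fintype ι] [DecidableEq ι] [Fintype κ]
    (M : Matrix κ ι ℝ) (y : ι → ℝ) (z : κ → ℝ) (p : ι → ℝ) :
    ((y + z ᵥ* M) ⬝ᵥ (1 + Mᵀ * M)⁻¹ *ᵥ p) ^ 2 ≤
      (y ⬝ᵥ y + z ⬝ᵥ z) * (p ⬝ᵥ (1 + Mᵀ * M)⁻¹ *ᵥ p) := by
  set g := 1 + Mᵀ * M with hg
  have hdet : IsUnit g.det := isUnit_iff_ne_zero.mpr (posDef_one_add M).det_pos.ne'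
  set c := g⁻¹ *ᵥ p with hc
  have hp : p = g *ᵥ c := by rw [hc, mulVec_mulVec, mul_nonsing_inv g hdet, one_mulVec]
  have h1 : p ⬝ᵥ c = c ⬝ᵥ c + (M *ᵥ c) ⬝ᵥ (M *ᵥ c) := by
    rw [hp, hg, add_mulVec, one_mulVec, add_dotProduct, ← mulVec_mulVec, mulVec_transpose,
      ← dotProduct_mulVec]
  rw [h1, add_dotProduct, ← dotProduct_mulVec]
  have e1 := Finset.sum_mul_sq_le_sq_mul_sq Finset.univ y c
  have e2 := Finset.sum_mul_sq_le_sq_mul_sq Finset.univ z (M *ᵥ c)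
  simp only [dotProduct, ← sq] at *
  set A := ∑ i, y i ^ 2
  set B := ∑ i, z i ^ 2
  set C := ∑ i, c i ^ 2
  set D := ∑ i, (M *ᵥ c) i ^ 2
  set s := ∑ i, y i * c i
  set t := ∑ i, z i * (M *ᵥ c) i
  have hA : 0 ≤ A := Finset.sum_nonneg fun i _ => sq_nonneg _
  have hB : 0 ≤ B := Finset.sum_nonneg fun i _ => sq_nonneg _
  have hC : 0 ≤ C := Finset.sum_nonneg fun i _ => sq_nonneg _
  have hD : 0 ≤ D := Finset.sum_nonneg fun i _ => sq_nonneg _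
  have h2 : 2 * (s * t) ≤ A * D + B * C := by
    have : (s*t)^2 ≤ (A * D) * (B * C) := by
      calc (s*t)^2 = s^2 * t^2 := by ring
        _ ≤ (A * C) * (B * D) := by gcongr
        _ = _ := by ring
    have h4 : (2 * (s*t))^2 ≤ (A * D + B * C)^2 := by nlinarith [sq_nonneg (A*D-B*C)]
    exact abs_le_of_sq_le_sq' h4 (by positivity) |>.2
  nlinarith

lemma dotProduct_inv_le {ι κ : Type*} [Fintype ι] [DecidableEq ι] [Fintype κ]
    (M : Matrix κ ι ℝ) (p : ι → ℝ) :
    p ⬝ᵥ (1 + Mᵀ * M)⁻¹ *ᵥ p ≤ p ⬝ᵥ p := by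
  have h := sq_dotProduct_inv_le M p 0 p
  rw [zero_vecMul, add_zero, zero_dotProduct, add_zero] at h
  set u := p ⬝ᵥ (1 + Mᵀ * M)⁻¹ *ᵥ p
  have hp : 0 ≤ p ⬝ᵥ p := Finset.sum_nonneg fun i _ => mul_self_nonneg _
  by_contra! hlt
  nlinarith

lemma dotProduct_inv_self_le {ι κ : Type*} [Fintype ι] [DecidableEq ι] [Fintype κ]
    (M : Matrix κ ι ℝ) (y : ι → ℝ) (z : κ → ℝ) :
    (y + z ᵥ* M) ⬝ᵥ (1 + Mᵀ * M)⁻¹ *ᵥ (y + z ᵥ* M) ≤ y ⬝ᵥ y + z ⬝ᵥ z := by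
  have h := sq_dotProduct_inv_le M y z (y + z ᵥ* M)
  set u := (y + z ᵥ* M) ⬝ᵥ (1 + Mᵀ * M)⁻¹ *ᵥ (y + z ᵥ* M)
  have hp : 0 ≤ y ⬝ᵥ y + z ⬝ᵥ z := add_nonneg (Finset.sum_nonneg fun i _ => mul_self_nonneg _)
    (Finset.sum_nonneg fun i _ => mul_self_nonneg _)
  by_contra! hlt
  nlinarith

lemma dotProduct_adjugate_rank_one_le {ι κ : Type*} [Fintype ι] [DecidableEq ι]
    [Fintype κ] [DecidableEq κ]
    (M : Matrix κ ι ℝ) (l : ℕ)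
    (hl : M.rank ≤ l) (p : ι → ℝ) (q : κ → ℝ) :
    p ⬝ᵥ (1 + (M + vecMulVec q p)ᵀ * (M + vecMulVec q p)).adjugate *ᵥ p ≤
      (p ⬝ᵥ p) * (1 + (Mᵀ * M).trace) ^ l := by
  have e : 1 + (M + vecMulVec q p)ᵀ * (M + vecMulVec q p) =
      (1 + Mᵀ * M) + vecMulVec p (q ᵥ* M + (q ⬝ᵥ q) • p) + vecMulVec (q ᵥ* M) p := by
    rw [transpose_add, transpose_vecMulVec, Matrix.add_mul, Matrix.mul_add, Matrix.mul_add,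
      vecMulVec_add,
      vecMulVec_mul, vecMulVec_mul_vecMulVec, mul_vecMulVec, mulVec_transpose, vecMulVec_smul]
    abel
  have hd0 := (posDef_one_add M).det_pos
  have hd1 := (posDef_one_add (M + vecMulVec q p)).det_pos
  rw [e] at hd1 ⊢
  rw [dotProduct_adjugate_add_vecMulVec _ hd0.ne' _ _ _ hd1.ne',
    dotProduct_adjugate_eq _ hd0.ne', mul_comm]
  have h1 := det_one_add_le M l hl
  have h2 := dotProduct_inv_le M p
  have hp : 0 ≤ p ⬝ᵥ p := Finset.sum_nonneg fun i _ => mul_self_nonneg _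
  calc _ ≤ (p ⬝ᵥ p) * (1 + Mᵀ * M).det := by gcongr
    _ ≤ _ := by gcongr

end LinAlg

abbrev Eu (n : ℕ) := EuclideanSpace ℝ (Fin (n+1))

section Pointwise
open Matrix

/-- The matrix of a linear map in the standard bases. -/
noncomputable def jacMat {n m : ℕ} (P : Eu n →L[ℝ] Eu m) : Matrix (Fin (m+1)) (Fin (n+1)) ℝ :=
  fun α i => P (EuclideanSpace.single i 1) α

/-- The metric induced on the graph of a linear map. -/
noncomputable def gramMat {n m : ℕ} (P : Eu n →L[ℝ] Eu m) : Matrix (Fin (n+1)) (Fin (n+1)) ℝ :=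
  fun i j => (if i = j then (1:ℝ) else 0) +
    ∑ α : Fin (m+1), P (EuclideanSpace.single i 1) α * P (EuclideanSpace.single j 1) α

/-- The coordinates of a covector. -/
noncomputable def covec {n : ℕ} : (Eu n →L[ℝ] ℝ) →ₗ[ℝ] (Fin (n+1) → ℝ) where
  toFun p i := p (EuclideanSpace.single i 1)
  map_add' _ _ := rfl
  map_smul' _ _ := rfl

/-- The volume density of the graph. -/
noncomputable def volDens {n m : ℕ} (P : Eu n →L[ℝ] Eu m) : ℝ := Real.sqrt (gramMat P).det

/-- The bilinear form `√g g^{ij} p_j q_i`. -/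
noncomputable def mssForm {n m : ℕ} (P : Eu n →L[ℝ] Eu m) :
    (Eu n →L[ℝ] ℝ) →ₗ[ℝ] (Eu n →L[ℝ] ℝ) →ₗ[ℝ] ℝ :=
  LinearMap.mk₂ ℝ (fun p q => volDens P * (covec q ⬝ᵥ (gramMat P)⁻¹ *ᵥ covec p))
    (fun _ _ _ => by simp only [map_add, mulVec_add, dotProduct_add]; ring)
    (fun _ _ _ => by simp only [map_smul, mulVec_smul, dotProduct_smul, smul_eq_mul]; ring)
    (fun _ _ _ => by simp only [map_add, add_dotProduct]; ring)
    (fun _ _ _ => by simp only [map_smul, smul_dotProduct, smul_eq_mul]; ring)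

/-- The squared area density of a slice of the graph conormal to `p`, scaled by `|p|²`. -/
noncomputable def sliceDens {n m : ℕ} (P : Eu n →L[ℝ] Eu m) (p : Eu n →L[ℝ] ℝ) : ℝ :=
  covec p ⬝ᵥ (gramMat P).adjugate *ᵥ covec p

/-- The differential of the `i`-th coordinate. -/
noncomputable abbrev dcoord {n : ℕ} (i : Fin (n+1)) : Eu n →L[ℝ] ℝ := EuclideanSpace.proj i

variable {n m : ℕ}

lemma mssForm_apply (P : Eu n →L[ℝ] Eu m) (p q : Eu n →L[ℝ] ℝ) :
    mssForm P p q = volDens P * (covec q ⬝ᵥ (gramMat P)⁻¹ *ᵥ covec p) := rfl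

lemma gramMat_eq (P : Eu n →L[ℝ] Eu m) : gramMat P = 1 + (jacMat P)ᵀ * jacMat P := by
  ext i j
  simp [gramMat, jacMat, Matrix.mul_apply, Matrix.one_apply]

lemma gramMat_posDef (P : Eu n →L[ℝ] Eu m) : (gramMat P).PosDef := by
  rw [gramMat_eq]; exact posDef_one_add _

lemma volDens_pos (P : Eu n →L[ℝ] Eu m) : 0 < volDens P :=
  Real.sqrt_pos.mpr (gramMat_posDef P).det_pos

lemma mssForm_eq_sum (P : Eu n →L[ℝ] Eu m) (p q : Eu n →L[ℝ] ℝ) :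
    mssForm P p q = ∑ i, ∑ j, Real.sqrt (gramMat P).det * (gramMat P)⁻¹ i j *
      p (EuclideanSpace.single j 1) * q (EuclideanSpace.single i 1) := by
  rw [mssForm_apply, dotProduct, Finset.mul_sum]
  refine Finset.sum_congr rfl fun i _ => ?_
  rw [mulVec, dotProduct, Finset.mul_sum, Finset.mul_sum]
  refine Finset.sum_congr rfl fun j _ => ?_
  simp only [volDens, covec, LinearMap.coe_mk, AddHom.coe_mk]
  ring

lemma covec_dcoord (j : Fin (n+1)) : covec (dcoord j) = Pi.single j (1:ℝ) := by
  ext i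
  simp [covec, Pi.single_apply, eq_comm]

lemma mssForm_dcoord (P : Eu n →L[ℝ] Eu m) (j : Fin (n+1)) (q : Eu n →L[ℝ] ℝ) :
    mssForm P (dcoord j) q = ∑ i, Real.sqrt (gramMat P).det * (gramMat P)⁻¹ i j *
      q (EuclideanSpace.single i 1) := by
  rw [mssForm_apply, covec_dcoord, mulVec_single_one, dotProduct, Finset.mul_sum]
  refine Finset.sum_congr rfl fun i _ => ?_
  simp only [volDens, covec, LinearMap.coe_mk, AddHom.coe_mk, Matrix.col_apply]
  ring

lemma continuous_gramMat : Continuous (gramMat : (Eu n →L[ℝ] Eu m) → _) := by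
  refine continuous_matrix fun i j => ?_
  unfold gramMat
  fun_prop

lemma continuous_volDens : Continuous (volDens : (Eu n →L[ℝ] Eu m) → ℝ) :=
  continuous_gramMat.matrix_det.sqrt

lemma continuous_covec : Continuous (covec : (Eu n →L[ℝ] ℝ) → _) :=
  covec.continuous_of_finiteDimensional

lemma continuous_gramMat_inv : Continuous fun P : Eu n →L[ℝ] Eu m => (gramMat P)⁻¹ := by
  have h : (fun P : Eu n →L[ℝ] Eu m => (gramMat P)⁻¹) =
      fun P => (gramMat P).det⁻¹ • (gramMat P).adjugate := by
    ext1 P; rw [Matrix.inv_def, Ring.inverse_eq_inv']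
  rw [h]
  exact (continuous_gramMat.matrix_det.inv₀ fun P => (gramMat_posDef P).det_pos.ne').smul
    continuous_gramMat.matrix_adjugate

lemma continuous_mssForm :
    Continuous fun x : (Eu n →L[ℝ] Eu m) × (Eu n →L[ℝ] ℝ) × (Eu n →L[ℝ] ℝ) =>
      mssForm x.1 x.2.1 x.2.2 := by
  simp only [mssForm_apply]
  refine (continuous_volDens.comp continuous_fst).mul (Continuous.dotProduct ?_ ?_)
  · exact continuous_covec.comp continuous_snd.snd
  · exact (continuous_gramMat_inv.comp continuous_fst).matrix_mulVec
      (continuous_covec.comp continuous_snd.fst)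

lemma continuous_sliceDens :
    Continuous fun x : (Eu n →L[ℝ] Eu m) × (Eu n →L[ℝ] ℝ) => sliceDens x.1 x.2 := by
  refine Continuous.dotProduct (continuous_covec.comp continuous_snd) ?_
  exact (continuous_gramMat.comp continuous_fst).matrix_adjugate.matrix_mulVec
      (continuous_covec.comp continuous_snd)

lemma exists_abs_mssForm_le (K : ℝ) : ∃ C, 0 ≤ C ∧ ∀ P : Eu n →L[ℝ] Eu m, ‖P‖ ≤ K →
    ∀ p q, |mssForm P p q| ≤ C * ‖p‖ * ‖q‖ := by
  obtain ⟨C, hC⟩ := ((isCompact_closedBall (0 : Eu n →L[ℝ] Eu m) K).prod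
    ((isCompact_closedBall (0 : Eu n →L[ℝ] ℝ) 1).prod
      (isCompact_closedBall (0 : Eu n →L[ℝ] ℝ) 1))).exists_bound_of_continuousOn
    (continuous_mssForm (n := n) (m := m)).continuousOn
  refine ⟨max C 0, le_max_right _ _, fun P hP p q => ?_⟩
  have hu : ∀ r : Eu n →L[ℝ] ℝ, ∃ r', ‖r'‖ ≤ 1 ∧ r = ‖r‖ • r' := by
    intro r
    rcases eq_or_ne r 0 with rfl | hr
    · exact ⟨0, by simp, by simp⟩
    · refine ⟨‖r‖⁻¹ • r, ?_, ?_⟩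
      · rw [norm_smul, norm_inv, norm_norm, inv_mul_cancel₀ (norm_ne_zero_iff.mpr hr)]
      · rw [smul_smul, mul_inv_cancel₀ (norm_ne_zero_iff.mpr hr), one_smul]
  obtain ⟨p', hp', hp⟩ := hu p
  obtain ⟨q', hq', hq⟩ := hu q
  have h := hC (P, p', q') (by simp [hP, hp', hq'])
  rw [Real.norm_eq_abs] at h
  have e : mssForm P p q = ‖p‖ * (‖q‖ * mssForm P p' q') := by
    conv_lhs => rw [hp, hq]
    simp only [map_smul, LinearMap.smul_apply, smul_eq_mul]
    ring
  rw [e, abs_mul, abs_mul, abs_norm, abs_norm]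
  calc ‖p‖ * (‖q‖ * |mssForm P p' q'|) ≤ ‖p‖ * (‖q‖ * max C 0) := by
        gcongr; exact h.trans (le_max_left _ _)
    _ = _ := by ring

lemma covec_injective : Function.Injective (covec : (Eu n →L[ℝ] ℝ) → _) := by
  intro p q h
  have : (p : Eu n →ₗ[ℝ] ℝ) = q := by
    refine (EuclideanSpace.basisFun (Fin (n+1)) ℝ).toBasis.ext fun i => ?_
    simpa [covec] using congrFun h i
  exact ContinuousLinearMap.coe_injective this

lemma mssForm_self_pos (P : Eu n →L[ℝ] Eu m) {p : Eu n →L[ℝ] ℝ} (hp : p ≠ 0) :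
    0 < mssForm P p p := by
  rw [mssForm_apply]
  refine mul_pos (volDens_pos P) ?_
  have h0 : covec p ≠ 0 := fun h => hp (covec_injective (by rw [h, map_zero]))
  simpa using (gramMat_posDef P).inv.dotProduct_mulVec_pos h0

lemma exists_le_mssForm {K : ℝ} (hK : 0 ≤ K) : ∃ c, 0 < c ∧ ∀ P : Eu n →L[ℝ] Eu m, ‖P‖ ≤ K →
    ∀ p, c * ‖p‖ ^ 2 ≤ mssForm P p p := by
  have hne : (Metric.closedBall (0 : Eu n →L[ℝ] Eu m) K ×ˢ
      Metric.sphere (0 : Eu n →L[ℝ] ℝ) 1).Nonempty :=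
    (Metric.nonempty_closedBall.mpr hK).prod (NormedSpace.sphere_nonempty.mpr zero_le_one)
  obtain ⟨x, hx, hmin⟩ := ((isCompact_closedBall (0 : Eu n →L[ℝ] Eu m) K).prod
    (isCompact_sphere (0 : Eu n →L[ℝ] ℝ) 1)).exists_isMinOn hne
    (f := fun x => mssForm x.1 x.2 x.2)
    (continuous_mssForm.comp (continuous_fst.prodMk
      (continuous_snd.prodMk continuous_snd))).continuousOn
  refine ⟨mssForm x.1 x.2 x.2, mssForm_self_pos _ ?_, fun P hP p => ?_⟩
  · rintro h
    have := hx.2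
    rw [h] at this
    simp at this
  · rcases eq_or_ne p 0 with rfl | hp
    · simp
    have hn := norm_ne_zero_iff.mpr hp
    have h := hmin (a := (P, ‖p‖⁻¹ • p)) ⟨by simpa using hP, by simp [norm_smul, hn]⟩
    change mssForm x.1 x.2 x.2 ≤ mssForm P (‖p‖⁻¹ • p) (‖p‖⁻¹ • p) at h
    simp only [map_smul, LinearMap.smul_apply, smul_eq_mul] at h
    have e : mssForm P p p = (‖p‖⁻¹ * (‖p‖⁻¹ * mssForm P p p)) * ‖p‖ ^ 2 := by
      field_simp
    rw [e]
    gcongr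

/-- The pull-back of the `α`-th coordinate by `P`. -/
noncomputable abbrev dcomp (P : Eu n →L[ℝ] Eu m) (α : Fin (m+1)) : Eu n →L[ℝ] ℝ :=
  (dcoord α).comp P

lemma sum_mssForm (P : Eu n →L[ℝ] Eu m) :
    ∑ j, mssForm P (dcoord j) (dcoord j) + ∑ α, mssForm P (dcomp P α) (dcomp P α) =
      (n + 1) * volDens P := by
  have hd : IsUnit (gramMat P).det := isUnit_iff_ne_zero.mpr (gramMat_posDef P).det_pos.ne'
  have h1 : ((gramMat P)⁻¹ * (gramMat P)).trace = (n + 1 : ℝ) := by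
    rw [nonsing_inv_mul _ hd, trace_one]; simp
  have h2 : ∀ i j, gramMat P j i = ∑ k, dcoord k (EuclideanSpace.single j (1:ℝ)) *
      dcoord k (EuclideanSpace.single i (1:ℝ)) + ∑ α, dcomp P α (EuclideanSpace.single j (1:ℝ)) *
      dcomp P α (EuclideanSpace.single i (1:ℝ)) := by
    intro i j
    simp [gramMat, Finset.sum_ite_eq, eq_comm]
  rw [← h1, trace, Finset.sum_mul]
  simp only [mssForm_eq_sum, diag_apply, Matrix.mul_apply]
  rw [Finset.sum_comm, Finset.sum_comm (s := (Finset.univ : Finset (Fin (m+1)))),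
    ← Finset.sum_add_distrib]
  refine Finset.sum_congr rfl fun i _ => ?_
  rw [Finset.sum_comm, Finset.sum_comm (s := (Finset.univ : Finset (Fin (m+1)))),
    ← Finset.sum_add_distrib, Finset.sum_mul]
  refine Finset.sum_congr rfl fun j _ => ?_
  rw [h2 i j, volDens, mul_add, add_mul, Finset.mul_sum, Finset.mul_sum, Finset.sum_mul,
    Finset.sum_mul]
  congr 1 <;> exact Finset.sum_congr rfl fun _ _ => by ring

/-- The differential of half the squared distance, along the graph. -/
noncomputable def dhalf (P : Eu n →L[ℝ] Eu m) (y : Eu n) (z : Eu m) : Eu n →L[ℝ] ℝ :=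
  ∑ j, y j • dcoord j + ∑ α, z α • dcomp P α

lemma covec_dhalf (P : Eu n →L[ℝ] Eu m) (y : Eu n) (z : Eu m) :
    covec (dhalf P y z) = (y : Fin (n+1) → ℝ) + (z : Fin (m+1) → ℝ) ᵥ* jacMat P := by
  rw [dhalf, map_add, map_sum, map_sum]
  simp only [map_smul, covec_dcoord]
  ext i
  simp [Finset.sum_apply, Pi.single_apply, vecMul, dotProduct, covec, jacMat]

lemma dotProduct_self_eq (y : Eu n) :
    (y : Fin (n+1) → ℝ) ⬝ᵥ (y : Fin (n+1) → ℝ) = ‖y‖ ^ 2 := by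
  rw [EuclideanSpace.norm_sq_eq, dotProduct]
  exact Finset.sum_congr rfl fun i _ => by rw [Real.norm_eq_abs, sq_abs, sq]

lemma mssForm_dhalf_self_le (P : Eu n →L[ℝ] Eu m) (y : Eu n) (z : Eu m) :
    mssForm P (dhalf P y z) (dhalf P y z) ≤ volDens P * (‖y‖ ^ 2 + ‖z‖ ^ 2) := by
  rw [mssForm_apply, covec_dhalf, ← dotProduct_self_eq, ← dotProduct_self_eq, gramMat_eq]
  exact mul_le_mul_of_nonneg_left (dotProduct_inv_self_le _ _ _) (volDens_pos P).le

lemma sliceDens_eq (P : Eu n →L[ℝ] Eu m) (p : Eu n →L[ℝ] ℝ) :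
    sliceDens P p = (gramMat P).det * (covec p ⬝ᵥ (gramMat P)⁻¹ *ᵥ covec p) :=
  dotProduct_adjugate_eq _ (gramMat_posDef P).det_pos.ne' _ _

lemma sliceDens_nonneg (P : Eu n →L[ℝ] Eu m) (p : Eu n →L[ℝ] ℝ) : 0 ≤ sliceDens P p := by
  rw [sliceDens_eq]
  refine mul_nonneg (gramMat_posDef P).det_pos.le ?_
  simpa using (gramMat_posDef P).inv.posSemidef.dotProduct_mulVec_nonneg (covec p)

lemma sq_mssForm_dhalf_le (P : Eu n →L[ℝ] Eu m) (y : Eu n) (z : Eu m) (p : Eu n →L[ℝ] ℝ) :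
    mssForm P (dhalf P y z) p ^ 2 ≤ (‖y‖ ^ 2 + ‖z‖ ^ 2) * sliceDens P p := by
  have hsymm : ((gramMat P)⁻¹)ᵀ = (gramMat P)⁻¹ := by
    simpa using (gramMat_posDef P).inv.isHermitian.eq
  rw [mssForm_apply, sliceDens_eq, dotProduct_mulVec, ← mulVec_transpose, hsymm,
    dotProduct_comm, covec_dhalf, ← dotProduct_self_eq, ← dotProduct_self_eq, mul_pow, volDens,
    Real.sq_sqrt (gramMat_posDef P).det_pos.le, mul_left_comm]
  refine mul_le_mul_of_nonneg_left ?_ (gramMat_posDef P).det_pos.le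
  rw [gramMat_eq]
  exact sq_dotProduct_inv_le _ _ _ _

end Pointwise

section Pointwise2
open Matrix
variable {n m : ℕ}

lemma jacMat_add_smulRight (P : Eu n →L[ℝ] Eu m) (p : Eu n →L[ℝ] ℝ) (v : Eu m) :
    jacMat (P + p.smulRight v) = jacMat P + vecMulVec (v : Fin (m+1) → ℝ) (covec p) := by
  ext α i
  simp [jacMat, covec, vecMulVec_apply, mul_comm]

lemma toEuclideanLin_jacMat (P : Eu n →L[ℝ] Eu m) :
    toEuclideanLin (jacMat P) = (P : Eu n →ₗ[ℝ] Eu m) := by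
  refine (EuclideanSpace.basisFun (Fin (n+1)) ℝ).toBasis.ext fun i => ?_
  ext α
  simp [jacMat]

lemma rank_jacMat (P : Eu n →L[ℝ] Eu m) :
    (jacMat P).rank = Module.finrank ℝ (LinearMap.range (P : Eu n →ₗ[ℝ] Eu m)) := by
  rw [← toEuclideanLin_jacMat, toEuclideanLin, toLpLin_eq_toLin, ← rank_eq_finrank_range_toLin]

lemma trace_jacMat_le (P : Eu n →L[ℝ] Eu m) :
    ((jacMat P)ᵀ * jacMat P).trace ≤ (n + 1) * ‖P‖ ^ 2 := by
  have h : ∀ i, ((jacMat P)ᵀ * jacMat P) i i ≤ ‖P‖ ^ 2 := by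
    intro i
    have e : ((jacMat P)ᵀ * jacMat P) i i = ‖P (EuclideanSpace.single i 1)‖ ^ 2 := by
      rw [← dotProduct_self_eq]; rfl
    have := P.le_opNorm (EuclideanSpace.single i 1)
    rw [PiLp.norm_single, norm_one, mul_one] at this
    rw [e]; gcongr
  calc _ ≤ ∑ _i : Fin (n+1), ‖P‖ ^ 2 := Finset.sum_le_sum fun i _ => h i
    _ = _ := by simp

lemma covec_dotProduct_self_le (p : Eu n →L[ℝ] ℝ) :
    covec p ⬝ᵥ covec p ≤ (n + 1) * ‖p‖ ^ 2 := by
  calc _ ≤ ∑ _i : Fin (n+1), ‖p‖ ^ 2 := by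
        refine Finset.sum_le_sum fun i _ => ?_
        have := p.le_opNorm (EuclideanSpace.single i 1)
        rw [PiLp.norm_single, norm_one, mul_one, Real.norm_eq_abs] at this
        rw [← sq, ← sq_abs]
        exact pow_le_pow_left₀ (abs_nonneg _) this 2
    _ = _ := by simp

lemma sliceDens_add_smulRight_le (P : Eu n →L[ℝ] Eu m) (l : ℕ)
    (hl : Module.finrank ℝ (LinearMap.range (P : Eu n →ₗ[ℝ] Eu m)) ≤ l)
    (p : Eu n →L[ℝ] ℝ) (v : Eu m) :
    sliceDens (P + p.smulRight v) p ≤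
      (n + 1) * ‖p‖ ^ 2 * (1 + (n + 1) * ‖P‖ ^ 2) ^ l := by
  rw [sliceDens, gramMat_eq, jacMat_add_smulRight]
  refine (dotProduct_adjugate_rank_one_le _ l (by rwa [rank_jacMat]) _ _).trans ?_
  have h0 : 0 ≤ ((jacMat P)ᵀ * jacMat P).trace :=
    (posSemidef_transpose_mul _).trace_nonneg
  exact mul_le_mul (covec_dotProduct_self_le p)
    (pow_le_pow_left₀ (by linarith) (by linarith [trace_jacMat_le P]) l) (by positivity)
    (by positivity)

open scoped MatrixOrder in
/-- The induced metric is the pull-back of the Euclidean one by a linear map whose Jacobian is the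
volume density. -/
lemma exists_linearMap_norm_sq_eq (P : Eu n →L[ℝ] Eu m) :
    ∃ L : Eu n →ₗ[ℝ] Eu n, |LinearMap.det L| = volDens P ∧
      ∀ z, ‖z‖ ^ 2 + ‖P z‖ ^ 2 = ‖L z‖ ^ 2 := by
  obtain ⟨B, hB⟩ := CStarAlgebra.nonneg_iff_eq_star_mul_self.mp
    (gramMat_posDef P).posSemidef.nonneg
  have hB' : gramMat P = Bᵀ * B := by simpa [star_eq_conjTranspose] using hB
  refine ⟨toEuclideanLin B, ?_, fun z => ?_⟩
  · rw [toEuclideanLin, toLpLin_eq_toLin, LinearMap.det_toLin, volDens, hB', det_mul, det_transpose,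
      Real.sqrt_mul_self_eq_abs]
  · have e1 : (z : Fin (n+1) → ℝ) ⬝ᵥ gramMat P *ᵥ (z : Fin (n+1) → ℝ) =
        ‖toEuclideanLin B z‖ ^ 2 := by
      rw [hB', ← mulVec_mulVec, mulVec_transpose, ← dotProduct_self_eq, dotProduct_comm,
        ← dotProduct_mulVec]
      rfl
    have e2 : ((P z : Eu m) : Fin (m+1) → ℝ) = jacMat P *ᵥ (z : Fin (n+1) → ℝ) := by
      conv_lhs => rw [← ContinuousLinearMap.coe_coe, ← toEuclideanLin_jacMat]
      rfl
    rw [← e1, gramMat_eq, add_mulVec, one_mulVec, dotProduct_add, dotProduct_self_eq,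
      ← mulVec_mulVec, mulVec_transpose, dotProduct_comm _ (vecMul _ _), ← dotProduct_mulVec, ← e2,
      dotProduct_self_eq]

lemma volume_ellipsoid (P : Eu n →L[ℝ] Eu m) (x₀ : Eu n) {r : ℝ} (hr : 0 < r) :
    ENNReal.ofReal (volDens P) *
      volume {x : Eu n | ‖x - x₀‖ ^ 2 + ‖P (x - x₀)‖ ^ 2 < r ^ 2} =
      ENNReal.ofReal (r ^ (n + 1)) * volume (Metric.ball (0 : Eu n) 1) := by
  obtain ⟨L, hdet, hL⟩ := exists_linearMap_norm_sq_eq P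
  have hd : LinearMap.det L ≠ 0 := by
    intro h; rw [h, abs_zero] at hdet; exact (volDens_pos P).ne hdet
  have hset : {x : Eu n | ‖x - x₀‖ ^ 2 + ‖P (x - x₀)‖ ^ 2 < r ^ 2} =
      (fun x => x + -x₀) ⁻¹' (L ⁻¹' Metric.ball 0 r) := by
    ext x
    simp only [Set.mem_preimage, mem_ball_zero_iff, ← sub_eq_add_neg]
    change ‖x - x₀‖ ^ 2 + ‖P (x - x₀)‖ ^ 2 < r ^ 2 ↔ ‖L (x - x₀)‖ < r
    rw [hL, sq_lt_sq₀ (norm_nonneg _) hr.le]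
  rw [hset, measure_preimage_add_right, Measure.addHaar_preimage_linearMap _ hd,
    Measure.addHaar_ball _ _ hr.le, ← mul_assoc, abs_inv, hdet,
    ← ENNReal.ofReal_mul (volDens_pos P).le, mul_inv_cancel₀ (volDens_pos P).ne',
    ENNReal.ofReal_one, one_mul]
  simp

end Pointwise2

section Mollify
open Filter Topology Metric
open scoped Convolution

variable {n : ℕ}

lemma LipschitzWith.hasFDerivAt_convolution {φ : Eu n → ℝ} {C : NNReal} (hφ : LipschitzWith C φ)
    {k : Eu n → ℝ} (hk : Continuous k) (hks : HasCompactSupport k) (x₀ : Eu n) :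
    HasFDerivAt (k ⋆[ContinuousLinearMap.lsmul ℝ ℝ, volume] φ)
      ((k ⋆[ContinuousLinearMap.lsmul ℝ ℝ, volume] fderiv ℝ φ) x₀) x₀ := by
  have hki : Integrable k := hk.integrable_of_hasCompactSupport hks
  have hkφ : ∀ x, Integrable fun t => k t • φ (x - t) := fun x =>
    (hk.smul (hφ.continuous.comp
      (continuous_const.sub continuous_id))).integrable_of_hasCompactSupport
      hks.smul_right
  have := hasFDerivAt_integral_of_dominated_loc_of_lip (μ := (volume : Measure (Eu n)))
    (F := fun x t => k t • φ (x - t)) (F' := fun t => k t • fderiv ℝ φ (x₀ - t)) (x₀ := x₀)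
    (bound := fun t => ‖k t‖ * C) (s := Set.univ) univ_mem
    (Eventually.of_forall fun x => (hkφ x).aestronglyMeasurable) (hkφ x₀) ?_ ?_ ?_ ?_
  · exact this.2
  · refine hk.aestronglyMeasurable.smul ?_
    exact ((measurable_fderiv ℝ φ).comp (measurable_const.sub measurable_id)).aestronglyMeasurable
  · refine Eventually.of_forall fun t => LipschitzWith.lipschitzOnWith ?_
    refine LipschitzWith.of_dist_le_mul fun x y => ?_
    rw [dist_smul₀, Real.coe_nnabs, abs_of_nonneg (by positivity), mul_assoc]
    gcongr
    simpa using hφ.dist_le_mul (x - t) (y - t)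
  · exact hki.norm.mul_const _
  · have h := (volume : Measure (Eu n)).measurePreserving_sub_left x₀
    filter_upwards [h.quasiMeasurePreserving.ae hφ.ae_differentiableAt] with t ht
    exact ((hasFDerivAt_comp_sub t).mpr ht.hasFDerivAt).const_smul (k t)

/-- A vector field that is weakly divergence free against smooth test functions is so against
Lipschitz ones. -/
lemma integral_fderiv_apply_eq_zero {Ω : Set (Eu n)} (hΩ : IsOpen Ω) {v : Eu n → Eu n}
    (hv : IntegrableOn v Ω)
    (hw : ∀ φ : Eu n → ℝ, ContDiff ℝ (⊤ : ℕ∞) φ → HasCompactSupport φ → tsupport φ ⊆ Ω →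
      ∫ x in Ω, fderiv ℝ φ x (v x) = 0)
    {φ : Eu n → ℝ} {C : NNReal} (hφ : LipschitzWith C φ) (hc : HasCompactSupport φ)
    (hs : tsupport φ ⊆ Ω) : ∫ x in Ω, fderiv ℝ φ x (v x) = 0 := by
  obtain ⟨δ, hδ, hδs⟩ := hc.isCompact.exists_cthickening_subset_open hΩ hs
  let ψ : ℕ → ContDiffBump (0 : Eu n) := fun i =>
    { rIn := δ / 2 / (i + 1), rOut := δ / (i + 1), rIn_pos := by positivity,
      rIn_lt_rOut := by gcongr; linarith }
  have hψ0 : Tendsto (fun i => (ψ i).rOut) atTop (𝓝 0) := by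
    exact tendsto_const_div_atTop_nhds_zero_nat δ |>.comp (tendsto_add_atTop_nat 1) |>.congr
      fun i => by simp [ψ]
  have hloc : LocallyIntegrable (fderiv ℝ φ) := by
    refine (locallyIntegrable_const (C : ℝ)).mono (measurable_fderiv ℝ φ).aestronglyMeasurable
      (Eventually.of_forall fun x => ?_)
    simpa using norm_fderiv_le_of_lipschitz ℝ hφ
  have hlim := ContDiffBump.ae_convolution_tendsto_right_of_locallyIntegrable (μ := volume)
    (φ := ψ) (K := 2) hψ0 (Eventually.of_forall fun i => by
      simp only [ψ]; apply le_of_eq; field_simp) hloc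
  set f : ℕ → Eu n → ℝ := fun i => (ψ i).normed volume ⋆[ContinuousLinearMap.lsmul ℝ ℝ, volume] φ
  have hcs : ∀ i, HasCompactSupport ((ψ i).normed (volume : Measure (Eu n))) :=
    fun i => (ψ i).hasCompactSupport_normed
  have hder : ∀ i x, fderiv ℝ (f i) x =
      ((ψ i).normed volume ⋆[ContinuousLinearMap.lsmul ℝ ℝ, volume] fderiv ℝ φ) x := fun i x =>
    (hφ.hasFDerivAt_convolution (ψ i).continuous_normed (hcs i) x).fderiv
  have hzero : ∀ i, ∫ x in Ω, fderiv ℝ (f i) x (v x) = 0 := by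
    intro i
    refine hw (f i) ?_ ?_ ?_
    · exact (hcs i).contDiff_convolution_left _ (ψ i).contDiff_normed
        hφ.continuous.locallyIntegrable
    · exact (hcs i).convolution _ hc
    · refine (closure_minimal ?_ isClosed_cthickening).trans hδs
      refine (support_convolution_subset _).trans ?_
      rintro _ ⟨a, ha, b, hb, rfl⟩
      rw [(ψ i).support_normed_eq, mem_ball_zero_iff] at ha
      have hr : (ψ i).rOut ≤ δ := div_le_self hδ.le (by linarith [(Nat.cast_nonneg i : (0:ℝ) ≤ i)])
      refine mem_cthickening_of_dist_le _ b _ _ (subset_tsupport φ hb) ?_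
      simpa using (ha.le.trans hr)
  have hbound : ∀ i x, ‖fderiv ℝ (f i) x‖ ≤ C := by
    intro i x
    rw [hder, convolution_def]
    calc _ ≤ ∫ t, (ψ i).normed volume t * (C : ℝ) := by
          refine norm_integral_le_of_norm_le ((ψ i).integrable_normed.mul_const _)
            (Eventually.of_forall fun t => ?_)
          rw [ContinuousLinearMap.lsmul_apply, norm_smul, Real.norm_eq_abs,
            abs_of_nonneg ((ψ i).nonneg_normed t)]
          exact mul_le_mul_of_nonneg_left (norm_fderiv_le_of_lipschitz ℝ hφ)
            ((ψ i).nonneg_normed t)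
      _ = C := by rw [integral_mul_const, (ψ i).integral_normed, one_mul]
  have ht : Tendsto (fun i => ∫ x in Ω, fderiv ℝ (f i) x (v x)) atTop
      (𝓝 (∫ x in Ω, fderiv ℝ φ x (v x))) := by
    refine tendsto_integral_of_dominated_convergence (fun x => C * ‖v x‖) (fun i => ?_)
      (hv.norm.const_mul _) (fun i => Eventually.of_forall fun x => ?_) ?_
    · exact isBoundedBilinearMap_apply.continuous.comp_aestronglyMeasurable
        ((measurable_fderiv ℝ (f i)).aestronglyMeasurable.prodMk hv.aestronglyMeasurable)
    · exact (ContinuousLinearMap.le_opNorm _ _).trans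
        (mul_le_mul_of_nonneg_right (hbound i x) (norm_nonneg _))
    · refine ae_restrict_of_ae (hlim.mono fun x hx => ?_)
      simp only [hder]
      exact ((ContinuousLinearMap.apply ℝ ℝ (v x)).continuous.tendsto _).comp hx
  simp only [hzero] at ht
  exact tendsto_nhds_unique ht tendsto_const_nhds |>.symm ▸ rfl

end Mollify

section Test
open Filter Topology Metric

variable {n m : ℕ}

/-- The open unit ball. -/
abbrev unitBall (n : ℕ) : Set (Eu n) := ball 0 1

/-- Functions that may be inserted into the weak equations. -/
structure IsTest (φ : Eu n → ℝ) : Prop where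
  exists_lip : ∃ C : NNReal, LipschitzOnWith C φ (closedBall 0 1)
  exists_zero : ∃ r < 1, ∀ x, r ≤ ‖x‖ → φ x = 0

lemma IsTest.bounded {φ : Eu n → ℝ} (h : IsTest φ) : ∃ M, 0 ≤ M ∧ ∀ x, |φ x| ≤ M := by
  obtain ⟨C, hC⟩ := h.exists_lip
  obtain ⟨M, hM⟩ := (isCompact_closedBall (0 : Eu n) 1).exists_bound_of_continuousOn
    hC.continuousOn
  obtain ⟨r, hr, h0⟩ := h.exists_zero
  refine ⟨max M 0, le_max_right _ _, fun x => ?_⟩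
  rcases le_or_gt r ‖x‖ with hx | hx
  · rw [h0 x hx, abs_zero]; exact le_max_right _ _
  · exact (hM x (by simpa using (hx.trans hr).le)).trans (le_max_left _ _)

lemma IsTest.lipschitz {φ : Eu n → ℝ} (h : IsTest φ) : ∃ C : NNReal, LipschitzWith C φ := by
  obtain ⟨M, hM0, hM⟩ := h.bounded
  obtain ⟨C, hC⟩ := h.exists_lip
  obtain ⟨r, hr, h0⟩ := h.exists_zero
  have hr' : 0 < 1 - r := by linarith
  have key : ∀ x y : Eu n, ‖x‖ ≤ 1 → ‖x‖ < r → 1 < ‖y‖ → |φ x - φ y| ≤ M / (1 - r) * dist x y := by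
    intro x y _ hx hy
    rw [h0 y (hr.trans hy).le, sub_zero]
    have hd : 1 - r ≤ dist x y := by
      have := norm_sub_norm_le y x
      rw [dist_comm, dist_eq_norm]; linarith
    calc |φ x| ≤ M := hM x
      _ = M / (1 - r) * (1 - r) := by field_simp
      _ ≤ _ := by gcongr
  have hCd : 0 ≤ M / (1 - r) := by positivity
  refine ⟨C + (M / (1 - r)).toNNReal, LipschitzWith.of_dist_le_mul fun x y => ?_⟩
  rw [NNReal.coe_add, Real.coe_toNNReal _ hCd, Real.dist_eq]
  have hn : 0 ≤ (C : ℝ) * dist x y := by positivity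
  have hn' : 0 ≤ M / (1 - r) * dist x y := by positivity
  rw [add_mul]
  rcases le_or_gt ‖x‖ 1 with hx | hx <;> rcases le_or_gt ‖y‖ 1 with hy | hy
  · have := hC.dist_le_mul x (by simpa using hx) y (by simpa using hy)
    rw [Real.dist_eq] at this
    linarith
  · rcases lt_or_ge ‖x‖ r with hxr | hxr
    · linarith [key x y hx hxr hy]
    · rw [h0 x hxr, h0 y (hr.trans hy).le]; simp; linarith
  · rcases lt_or_ge ‖y‖ r with hyr | hyr
    · rw [abs_sub_comm, dist_comm]
      rw [dist_comm] at hn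
      linarith [key y x hy hyr hx]
    · rw [h0 y hyr, h0 x (hr.trans hx).le]; simp; linarith
  · rw [h0 x (hr.trans hx).le, h0 y (hr.trans hy).le]; simp; linarith

lemma IsTest.tsupport_subset {φ : Eu n → ℝ} (h : IsTest φ) :
    HasCompactSupport φ ∧ tsupport φ ⊆ unitBall n := by
  obtain ⟨r, hr, h0⟩ := h.exists_zero
  have hs : tsupport φ ⊆ closedBall 0 r := by
    refine closure_minimal (fun x hx => ?_) isClosed_closedBall
    by_contra hn
    rw [mem_closedBall_zero_iff, not_le] at hn
    exact hx (h0 x hn.le)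
  exact ⟨(isCompact_closedBall _ _).of_isClosed_subset (isClosed_tsupport _) hs,
    hs.trans (closedBall_subset_ball hr)⟩

/-- A smooth function of the point and of a Lipschitz map, vanishing near the boundary. -/
lemma isTest_of_contDiff {F : Eu n → Eu m} {K : NNReal} (hF : LipschitzWith K F)
    {G : Eu n × Eu m → ℝ} (hG : ContDiff ℝ 1 G) {r : ℝ} (hr : r < 1)
    (h0 : ∀ x y, r ≤ ‖x‖ → G (x, y) = 0) : IsTest fun x => G (x, F x) := by
  refine ⟨?_, r, hr, fun x hx => h0 x _ hx⟩
  obtain ⟨M, hM⟩ := (isCompact_closedBall (0 : Eu n) 1).exists_bound_of_continuousOn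
    hF.continuous.continuousOn
  obtain ⟨C, hC⟩ := hG.contDiffOn.exists_lipschitzOnWith one_ne_zero
    ((convex_closedBall (0 : Eu n) 1).prod (convex_closedBall (0 : Eu m) M))
    ((isCompact_closedBall (0 : Eu n) 1).prod (isCompact_closedBall (0 : Eu m) M))
  refine ⟨C * max 1 K, hC.comp ((LipschitzWith.id.prodMk hF).lipschitzOnWith) fun x hx => ?_⟩
  exact ⟨hx, by simpa using hM x hx⟩

/-- A Lipschitz map solving the minimal surface system weakly in the unit ball, tested against
Lipschitz functions. -/
structure IsWeakSol (F : Eu n → Eu m) : Prop where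
  exists_lip : ∃ K : NNReal, LipschitzWith K F
  base : ∀ φ : Eu n → ℝ, IsTest φ → ∀ j : Fin (n+1),
    ∫ x in unitBall n, mssForm (fderiv ℝ F x) (dcoord j) (fderiv ℝ φ x) = 0
  fiber : ∀ φ : Eu n → ℝ, IsTest φ → ∀ α : Fin (m+1),
    ∫ x in unitBall n, mssForm (fderiv ℝ F x) (dcomp (fderiv ℝ F x) α) (fderiv ℝ φ x) = 0

lemma continuous_dcomp (α : Fin (m+1)) :
    Continuous fun P : Eu n →L[ℝ] Eu m => dcomp P α := by
  unfold dcomp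
  fun_prop

lemma norm_dcomp_le (P : Eu n →L[ℝ] Eu m) (α : Fin (m+1)) : ‖dcomp P α‖ ≤ ‖P‖ := by
  refine ContinuousLinearMap.opNorm_le_bound _ (norm_nonneg _) fun x => ?_
  exact (PiLp.norm_apply_le (P x) α).trans (P.le_opNorm x)

lemma norm_dcoord_le (j : Fin (n+1)) : ‖(dcoord j : Eu n →L[ℝ] ℝ)‖ ≤ 1 := by
  refine ContinuousLinearMap.opNorm_le_bound _ zero_le_one fun x => ?_
  rw [one_mul]
  exact PiLp.norm_apply_le x j

lemma measurable_mssForm {F : Eu n → Eu m} {p q : Eu n → Eu n →L[ℝ] ℝ} (hp : Measurable p)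
    (hq : Measurable q) : Measurable fun x => mssForm (fderiv ℝ F x) (p x) (q x) := by
  have h : Measurable fun x => (fderiv ℝ F x, p x, q x) :=
    (measurable_fderiv ℝ F).prodMk (hp.prodMk hq)
  have h' := (continuous_mssForm (n := n) (m := m)).measurable
  convert h'.comp h using 1
  rfl

lemma integrableOn_of_bounded {f : Eu n → ℝ} (hf : Measurable f) {C : ℝ}
    (hC : ∀ x ∈ unitBall n, |f x| ≤ C) : IntegrableOn f (unitBall n) :=
  IntegrableOn.of_bound measure_ball_lt_top hf.aestronglyMeasurable C
    ((ae_restrict_iff' measurableSet_ball).mpr (Eventually.of_forall hC))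

lemma integrableOn_mssForm {F : Eu n → Eu m} {K : NNReal} (hF : LipschitzWith K F)
    {p q : Eu n → Eu n →L[ℝ] ℝ} (hp : Measurable p) (hq : Measurable q) {Cp Cq : ℝ}
    (hCp : ∀ x ∈ unitBall n, ‖p x‖ ≤ Cp) (hCq : ∀ x ∈ unitBall n, ‖q x‖ ≤ Cq) :
    IntegrableOn (fun x => mssForm (fderiv ℝ F x) (p x) (q x)) (unitBall n) := by
  obtain ⟨C, hC0, hC⟩ := exists_abs_mssForm_le (n := n) (m := m) K
  refine integrableOn_of_bounded (measurable_mssForm hp hq) (C := C * Cp * Cq) fun x hx => ?_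
  have h1 := (norm_nonneg _).trans (hCp x hx)
  exact (hC _ (norm_fderiv_le_of_lipschitz ℝ hF) _ _).trans (by
    gcongr; exacts [hCp x hx, hCq x hx])

lemma apply_sum_mssForm (P : Eu n →L[ℝ] Eu m) (p q : Eu n →L[ℝ] ℝ) :
    q (∑ i, mssForm P p (dcoord i) • EuclideanSpace.single i (1:ℝ)) = mssForm P p q := by
  simp only [map_sum, map_smul, mssForm_apply, smul_eq_mul, covec_dcoord]
  conv_rhs => rw [dotProduct, Finset.mul_sum]
  refine Finset.sum_congr rfl fun i _ => ?_
  rw [single_one_dotProduct]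
  simp only [covec, LinearMap.coe_mk, AddHom.coe_mk]
  ring

lemma integral_mssForm_eq_zero_of_smooth {F : Eu n → Eu m} {K : NNReal} (hF : LipschitzWith K F)
    {p : Eu n → Eu n →L[ℝ] ℝ} (hp : Measurable p) {Cp : ℝ} (hCp : ∀ x, ‖p x‖ ≤ Cp)
    (hw : ∀ φ : Eu n → ℝ, ContDiff ℝ (⊤ : ℕ∞) φ → HasCompactSupport φ →
      tsupport φ ⊆ unitBall n → ∫ x in unitBall n, mssForm (fderiv ℝ F x) (p x) (fderiv ℝ φ x) = 0)
    {φ : Eu n → ℝ} (hφ : IsTest φ) :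
    ∫ x in unitBall n, mssForm (fderiv ℝ F x) (p x) (fderiv ℝ φ x) = 0 := by
  obtain ⟨v, hv⟩ : ∃ v : Eu n → Eu n, v = fun x =>
    ∑ i, mssForm (fderiv ℝ F x) (p x) (dcoord i) • EuclideanSpace.single i (1:ℝ) := ⟨_, rfl⟩
  have hq : ∀ x q, mssForm (fderiv ℝ F x) (p x) q = q (v x) := fun x q => by
    rw [hv, apply_sum_mssForm]
  simp only [hq] at hw ⊢
  obtain ⟨C, hC⟩ := hφ.lipschitz
  refine integral_fderiv_apply_eq_zero isOpen_ball ?_ hw hC hφ.tsupport_subset.1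
    hφ.tsupport_subset.2
  rw [hv]
  refine integrable_finsetSum _ fun i _ => Integrable.smul_const ?_ _
  exact integrableOn_mssForm hF hp measurable_const (fun x _ => hCp x) fun x _ => norm_dcoord_le i

/-- A solution of the Dirichlet problem extends to a global Lipschitz weak solution. -/
lemma IsMSSolution.exists_isWeakSol {f F : Eu n → Eu m} (h : IsMSSolution n m (unitBall n) f F) :
    ∃ F' : Eu n → Eu m, IsWeakSol F' ∧ ∀ x, ‖x‖ = 1 → F' x = f x := by
  obtain ⟨hcont, ⟨K, hK⟩, hbd, hweak⟩ := h
  have hcl : closure (unitBall n) = closedBall 0 1 := closure_ball _ one_ne_zero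
  have hfr : frontier (unitBall n) = sphere 0 1 := frontier_ball _ one_ne_zero
  have hK' : LipschitzOnWith K F (closedBall 0 1) := by
    rw [hcl] at hcont
    rw [← hcl]
    exact hK.closure (by rwa [hcl])
  obtain ⟨F', hF', heq⟩ := hK'.extend_finite_dimension
  refine ⟨F', ?_, fun x hx => ?_⟩
  · have hd : ∀ x ∈ unitBall n, fderiv ℝ F x = fderiv ℝ F' x := fun x hx => by
      refine Filter.EventuallyEq.fderiv_eq ?_
      filter_upwards [isOpen_ball.mem_nhds hx] with y hy using heq (ball_subset_closedBall hy)
    refine ⟨⟨_, hF'⟩, fun φ hφ j => ?_, fun φ hφ α => ?_⟩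
    · refine integral_mssForm_eq_zero_of_smooth hF' measurable_const
        (fun _ => norm_dcoord_le j) (fun φ h1 h2 h3 => ?_) hφ
      rw [← (hweak φ h1 h2 h3).1 j]
      refine setIntegral_congr_fun measurableSet_ball fun x hx => ?_
      simp only [mssForm_dcoord, ← hd x hx]
      rfl
    · refine integral_mssForm_eq_zero_of_smooth hF'
        ((continuous_dcomp α).measurable.comp (measurable_fderiv ℝ F'))
        (fun x => (norm_dcomp_le _ α).trans (norm_fderiv_le_of_lipschitz ℝ hF'))
        (fun φ h1 h2 h3 => ?_) hφ
      rw [← (hweak φ h1 h2 h3).2 α]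
      refine setIntegral_congr_fun measurableSet_ball fun x hx => ?_
      simp only [mssForm_eq_sum, Function.comp_apply, ← hd x hx]
      rfl
  · rw [← heq (by simp [hx])]
    exact hbd x (by rw [hfr]; simpa using hx)

end Test

section Defining
open Filter Topology Metric

variable {n m : ℕ}

/-- A defining function of the unit sphere. -/
noncomputable def bdf (x : Eu n) : ℝ := 1 - ‖x‖ ^ 2

lemma contDiff_bdf {k : WithTop ℕ∞} : ContDiff ℝ k (bdf : Eu n → ℝ) :=
  contDiff_const.sub (contDiff_norm_sq ℝ)

lemma bdf_pos {x : Eu n} (hx : x ∈ unitBall n) : 0 < bdf x := by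
  rw [mem_ball_zero_iff] at hx
  have := norm_nonneg x
  unfold bdf; nlinarith

lemma one_sub_norm_le_bdf {x : Eu n} (hx : x ∈ unitBall n) : 1 - ‖x‖ ≤ bdf x := by
  rw [mem_ball_zero_iff] at hx
  have := norm_nonneg x
  unfold bdf; nlinarith

lemma hasFDerivAt_bdf (x : Eu n) : HasFDerivAt bdf (fderiv ℝ bdf x) x :=
  ((contDiff_bdf (k := 1)).differentiable one_ne_zero x).hasFDerivAt

lemma norm_fderiv_bdf_le {x : Eu n} (hx : ‖x‖ ≤ 1) : ‖fderiv ℝ bdf x‖ ≤ 2 := by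
  have h : HasFDerivAt bdf (-(2 • innerSL ℝ x)) x := by
    have := ((hasStrictFDerivAt_norm_sq x).hasFDerivAt).const_sub 1
    exact this
  rw [h.fderiv, norm_neg, two_nsmul]
  refine (norm_add_le _ _).trans ?_
  rw [innerSL_apply_norm]
  linarith

/-- The shell where the cut-off of scale `δ` varies. -/
def layer (n : ℕ) (δ : ℝ) : Set (Eu n) := {x | δ ≤ bdf x ∧ bdf x ≤ 2 * δ}

lemma measurableSet_layer (δ : ℝ) : MeasurableSet (layer n δ) := by
  have h := (contDiff_bdf (n := n) (k := 1)).continuous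
  exact ((isClosed_le continuous_const h).inter (isClosed_le h continuous_const)).measurableSet

lemma layer_subset {δ : ℝ} (hδ : 0 < δ) : layer n δ ⊆ unitBall n := by
  intro x hx
  have h := hx.1
  unfold bdf at h
  rw [mem_ball_zero_iff]
  have := norm_nonneg x
  nlinarith

lemma volume_layer_ne_top {δ : ℝ} (hδ : 0 < δ) : volume (layer n δ) ≠ ⊤ :=
  ((measure_mono (layer_subset hδ)).trans_lt measure_ball_lt_top).ne

lemma volume_layer_le {δ : ℝ} (hδ : 0 < δ) (hδ' : δ ≤ 1 / 2) :
    volume.real (layer n δ) ≤ 2 * (n + 1) * volume.real (unitBall n) * δ := by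
  have hsub : layer n δ ⊆ unitBall n \ ball 0 (1 - 2 * δ) := by
    refine fun x hx => ⟨layer_subset hδ hx, fun h => ?_⟩
    have h1 := layer_subset hδ hx
    rw [mem_ball_zero_iff] at h h1
    have h2 := hx.2
    unfold bdf at h2
    have := norm_nonneg x
    nlinarith
  have hs : ball (0 : Eu n) (1 - 2 * δ) ⊆ unitBall n := ball_subset_ball (by linarith)
  have hr : volume.real (ball (0 : Eu n) (1 - 2 * δ)) =
      (1 - 2 * δ) ^ (n + 1) * volume.real (unitBall n) := by
    rw [measureReal_def, Measure.addHaar_ball _ _ (by linarith), ENNReal.toReal_mul,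
      ENNReal.toReal_ofReal (pow_nonneg (by linarith) _), finrank_euclideanSpace_fin]
    rfl
  calc volume.real (layer n δ) ≤ volume.real (unitBall n \ ball 0 (1 - 2 * δ)) :=
        measureReal_mono hsub ((measure_mono Set.sdiff_subset).trans_lt measure_ball_lt_top).ne
    _ = volume.real (unitBall n) - (1 - 2 * δ) ^ (n + 1) * volume.real (unitBall n) := by
        rw [measureReal_sdiff hs measurableSet_ball (measure_ball_lt_top.ne), hr]
    _ ≤ _ := by
        have hb := one_add_mul_le_pow (a := -(2 * δ)) (by linarith) (n + 1)
        have h0 : 0 ≤ volume.real (unitBall n) := measureReal_nonneg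
        push_cast at hb
        have : 1 - (1 - 2 * δ) ^ (n + 1) ≤ 2 * (n + 1) * δ := by
          rw [sub_eq_add_neg 1 (2 * δ)]; linarith
        nlinarith

lemma deriv_smoothTransition_eq_zero {t : ℝ} (ht : t ∉ Set.Icc (0:ℝ) 1) :
    deriv Real.smoothTransition t = 0 := by
  rw [Set.mem_Icc, not_and_or, not_le, not_le] at ht
  rcases ht with ht | ht
  · have h : Real.smoothTransition =ᶠ[𝓝 t] fun _ => 0 := by
      filter_upwards [Iio_mem_nhds ht] with s hs using Real.smoothTransition.zero_of_nonpos hs.le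
    rw [h.deriv_eq, deriv_const]
  · have h : Real.smoothTransition =ᶠ[𝓝 t] fun _ => 1 := by
      filter_upwards [Ioi_mem_nhds ht] with s hs using Real.smoothTransition.one_of_one_le hs.le
    rw [h.deriv_eq, deriv_const]

lemma exists_abs_deriv_smoothTransition_le : ∃ C, 0 ≤ C ∧
    ∀ t, |deriv Real.smoothTransition t| ≤ C := by
  have hc : Continuous (deriv Real.smoothTransition) :=
    (Real.smoothTransition.contDiff (n := 1)).continuous_deriv le_rfl
  obtain ⟨C, hC⟩ := (isCompact_Icc (a := (0:ℝ)) (b := 1)).exists_bound_of_continuousOn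
    hc.continuousOn
  refine ⟨max C 0, le_max_right _ _, fun t => ?_⟩
  by_cases ht : t ∈ Set.Icc (0:ℝ) 1
  · exact (hC t ht).trans (le_max_left _ _)
  · rw [deriv_smoothTransition_eq_zero ht, abs_zero]; exact le_max_right _ _

/-- The cut-off as a function of the defining function. -/
noncomputable def cutoff (δ t : ℝ) : ℝ := Real.smoothTransition (t / δ - 1)

lemma cutoff_eq_zero {δ t : ℝ} (hδ : 0 < δ) (h : t ≤ δ) : cutoff δ t = 0 :=
  Real.smoothTransition.zero_of_nonpos (by rw [sub_nonpos, div_le_one hδ]; exact h)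

lemma cutoff_eq_one {δ t : ℝ} (hδ : 0 < δ) (h : 2 * δ ≤ t) : cutoff δ t = 1 :=
  Real.smoothTransition.one_of_one_le (by rw [le_sub_iff_add_le, le_div_iff₀ hδ]; linarith)

lemma cutoff_nonneg (δ t : ℝ) : 0 ≤ cutoff δ t := Real.smoothTransition.nonneg _

lemma cutoff_le_one (δ t : ℝ) : cutoff δ t ≤ 1 := Real.smoothTransition.le_one _

lemma contDiff_cutoff (δ : ℝ) : ContDiff ℝ 1 (cutoff δ) :=
  Real.smoothTransition.contDiff.comp ((contDiff_id.div_const δ).sub contDiff_const)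

lemma hasDerivAt_cutoff (δ t : ℝ) : HasDerivAt (cutoff δ) (deriv (cutoff δ) t) t :=
  ((contDiff_cutoff δ).differentiable one_ne_zero t).hasDerivAt

lemma deriv_cutoff (δ t : ℝ) :
    deriv (cutoff δ) t = deriv Real.smoothTransition (t / δ - 1) / δ := by
  have h := (((Real.smoothTransition.contDiff (n := 1)).differentiable one_ne_zero
    (t / δ - 1)).hasDerivAt).comp t (((hasDerivAt_id t).div_const δ).sub_const 1)
  have h' : HasDerivAt (cutoff δ) _ t := h
  rw [h'.deriv]
  ring

lemma deriv_cutoff_eq_zero {δ : ℝ} (hδ : 0 < δ) {x : Eu n} (hx : x ∉ layer n δ) :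
    deriv (cutoff δ) (bdf x) = 0 := by
  rw [deriv_cutoff, deriv_smoothTransition_eq_zero, zero_div]
  rintro ⟨h1, h2⟩
  rw [sub_nonneg, le_div_iff₀ hδ] at h1
  rw [sub_le_iff_le_add, div_le_iff₀ hδ] at h2
  exact hx ⟨by linarith, by linarith⟩

lemma exists_abs_deriv_cutoff_le : ∃ C, 0 ≤ C ∧
    ∀ δ > 0, ∀ t, |deriv (cutoff δ) t| ≤ C / δ := by
  obtain ⟨C, hC0, hC⟩ := exists_abs_deriv_smoothTransition_le
  refine ⟨C, hC0, fun δ hδ t => ?_⟩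
  rw [deriv_cutoff, abs_div, abs_of_pos hδ]
  gcongr
  exact hC _

lemma contDiff_cutoff_mul {δ : ℝ} (hδ : 0 < δ) {g : ℝ → ℝ} (hg : ∀ t, 0 < t → ContDiffAt ℝ 1 g t) :
    ContDiff ℝ 1 fun t => cutoff δ t * g t := by
  rw [contDiff_iff_contDiffAt]
  intro t
  rcases lt_or_ge t δ with ht | ht
  · have h : (fun t => cutoff δ t * g t) =ᶠ[𝓝 t] fun _ => 0 := by
      filter_upwards [Iio_mem_nhds ht] with s hs
      rw [cutoff_eq_zero hδ (le_of_lt hs), zero_mul]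
    exact contDiffAt_const.congr_of_eventuallyEq h
  · exact (contDiff_cutoff δ).contDiffAt.mul (hg t (hδ.trans_le ht))

lemma bdf_le_of_le_norm {δ : ℝ} (hδ' : δ ≤ 1) {x : Eu n} (hx : 1 - δ / 2 ≤ ‖x‖) : bdf x ≤ δ := by
  have := mul_self_le_mul_self (by linarith) hx
  unfold bdf
  nlinarith [sq_nonneg δ]

lemma IsTest.mul_of_contDiff {φ g : Eu n → ℝ} (hφ : IsTest φ) (hg : ContDiff ℝ 1 g) :
    IsTest fun x => g x * φ x := by
  obtain ⟨C, hC⟩ := hφ.exists_lip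
  obtain ⟨M, hM0, hM⟩ := hφ.bounded
  obtain ⟨r, hr, h0⟩ := hφ.exists_zero
  obtain ⟨D, hD⟩ := hg.contDiffOn.exists_lipschitzOnWith one_ne_zero
    (convex_closedBall (0 : Eu n) 1) (isCompact_closedBall (0 : Eu n) 1)
  obtain ⟨N, hN⟩ := (isCompact_closedBall (0 : Eu n) 1).exists_bound_of_continuousOn
    hg.continuous.continuousOn
  refine ⟨⟨N.toNNReal * C + M.toNNReal * D, LipschitzOnWith.of_dist_le_mul fun x hx y hy => ?_⟩,
    r, hr, fun x hx => by rw [h0 x hx, mul_zero]⟩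
  have hNx := hN x hx
  have hN0 : 0 ≤ N := (norm_nonneg _).trans hNx
  have h1 := hC.dist_le_mul x hx y hy
  have h2 := hD.dist_le_mul x hx y hy
  rw [Real.dist_eq] at h1 h2 ⊢
  push_cast
  rw [Real.coe_toNNReal _ hN0, Real.coe_toNNReal _ hM0]
  calc |g x * φ x - g y * φ y| = |g x * (φ x - φ y) + (g x - g y) * φ y| := by ring_nf
    _ ≤ |g x| * |φ x - φ y| + |g x - g y| * |φ y| := by
        rw [← abs_mul, ← abs_mul]; exact abs_add_le _ _
    _ ≤ N * (C * dist x y) + D * dist x y * M := by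
        gcongr
        exacts [hNx, hM y]
    _ = _ := by ring

lemma IsTest.norm_fderiv_le {φ : Eu n → ℝ} (hφ : IsTest φ) : ∃ C, ∀ x, ‖fderiv ℝ φ x‖ ≤ C := by
  obtain ⟨C, hC⟩ := hφ.lipschitz
  exact ⟨C, fun x => norm_fderiv_le_of_lipschitz ℝ hC⟩

lemma IsTest.integrableOn_abs {φ : Eu n → ℝ} (hφ : IsTest φ) :
    IntegrableOn (fun x => |φ x|) (unitBall n) := by
  obtain ⟨C, hC⟩ := hφ.lipschitz
  obtain ⟨M, hM0, hM⟩ := hφ.bounded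
  exact integrableOn_of_bounded hC.continuous.abs.measurable (C := M) fun x _ => by
    rw [abs_abs]; exact hM x

lemma eq_sum_dcoord (p : Eu n →L[ℝ] ℝ) :
    p = ∑ j, p (EuclideanSpace.single j 1) • dcoord j := by
  refine covec_injective ?_
  ext i
  simp [Finset.sum_apply, covec]

/-- The operator applied weakly to a function of class `C²` is bounded. -/
lemma IsWeakSol.exists_abs_integral_le {F : Eu n → Eu m} (hF : IsWeakSol F) {h : Eu n → ℝ}
    (hh : ContDiff ℝ 2 h) : ∃ C, 0 ≤ C ∧ ∀ φ : Eu n → ℝ, IsTest φ →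
      |∫ x in unitBall n, mssForm (fderiv ℝ F x) (fderiv ℝ h x) (fderiv ℝ φ x)| ≤
        C * ∫ x in unitBall n, |φ x| := by
  obtain ⟨K, hK⟩ := hF.exists_lip
  obtain ⟨C, hC0, hC⟩ := exists_abs_mssForm_le (n := n) (m := m) K
  have hd : ContDiff ℝ 1 (fderiv ℝ h) := hh.fderiv_right (by norm_num)
  set hj : Fin (n+1) → Eu n → ℝ := fun j x => fderiv ℝ h x (EuclideanSpace.single j 1) with hjdef
  have hjc : ∀ j, ContDiff ℝ 1 (hj j) := fun j => hd.clm_apply contDiff_const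
  have hb : ∀ j, ∃ M, ∀ x ∈ closedBall (0 : Eu n) 1, ‖fderiv ℝ (hj j) x‖ ≤ M := fun j =>
    (isCompact_closedBall _ _).exists_bound_of_continuousOn
      ((hjc j).continuous_fderiv one_ne_zero).continuousOn
  choose M hM using hb
  have hM0 : ∀ j, 0 ≤ M j := fun j => (norm_nonneg _).trans (hM j 0 (by simp))
  refine ⟨∑ j, C * M j, Finset.sum_nonneg fun j _ => mul_nonneg hC0 (hM0 j), fun φ hφ => ?_⟩
  obtain ⟨Cφ, hCφ⟩ := hφ.lipschitz
  obtain ⟨Mφ, hMφ0, hMφ⟩ := hφ.bounded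
  have hterm : ∀ j, (IntegrableOn (fun x => hj j x *
        mssForm (fderiv ℝ F x) (dcoord j) (fderiv ℝ φ x)) (unitBall n)) ∧
      |∫ x in unitBall n, hj j x * mssForm (fderiv ℝ F x) (dcoord j) (fderiv ℝ φ x)| ≤
        C * M j * ∫ x in unitBall n, |φ x| := by
    intro j
    have ht := hφ.mul_of_contDiff (hjc j)
    obtain ⟨Ct, hCt⟩ := ht.norm_fderiv_le
    have h0 := hF.base _ ht j
    have hi1 := integrableOn_mssForm hK (p := fun _ => dcoord j)
      (q := fderiv ℝ fun x => hj j x * φ x) measurable_const (measurable_fderiv _ _)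
      (fun x _ => norm_dcoord_le j) (fun x _ => hCt x)
    have hi2' : IntegrableOn (fun x => mssForm (fderiv ℝ F x) (dcoord j) (fderiv ℝ (hj j) x))
      (unitBall n) := integrableOn_mssForm hK (p := fun _ => dcoord j)
      (q := fderiv ℝ (hj j)) measurable_const (measurable_fderiv _ _)
      (fun x _ => norm_dcoord_le j) (fun x hx => hM j x (ball_subset_closedBall hx))
    have hi2 : IntegrableOn (fun x => φ x * mssForm (fderiv ℝ F x) (dcoord j) (fderiv ℝ (hj j) x))
      (unitBall n) := hi2'.bdd_mul hCφ.continuous.aestronglyMeasurable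
        (Eventually.of_forall fun x => hMφ x)
    have hae : ∀ᵐ x ∂volume.restrict (unitBall n),
        hj j x * mssForm (fderiv ℝ F x) (dcoord j) (fderiv ℝ φ x) =
        mssForm (fderiv ℝ F x) (dcoord j) (fderiv ℝ (fun x => hj j x * φ x) x) -
        φ x * mssForm (fderiv ℝ F x) (dcoord j) (fderiv ℝ (hj j) x) := by
      refine ae_restrict_of_ae (hCφ.ae_differentiableAt.mono fun x hx => ?_)
      rw [fderiv_fun_mul ((hjc j).differentiable one_ne_zero x) hx, map_add, map_smul, map_smul,
        smul_eq_mul, smul_eq_mul]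
      ring
    refine ⟨(hi1.sub hi2).congr (hae.mono fun x hx => hx.symm), ?_⟩
    rw [integral_congr_ae hae, integral_sub hi1 hi2, h0, zero_sub, abs_neg, ←
        integral_const_mul, ← Real.norm_eq_abs]
    refine norm_integral_le_of_norm_le (hφ.integrableOn_abs.const_mul _) ?_
    refine (ae_restrict_iff' measurableSet_ball).mpr (Eventually.of_forall fun x hx => ?_)
    rw [Real.norm_eq_abs, abs_mul, mul_comm]
    refine mul_le_mul_of_nonneg_right ?_ (abs_nonneg _)
    refine (hC _ (norm_fderiv_le_of_lipschitz ℝ hK) _ _).trans ?_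
    refine mul_le_mul ?_ (hM j x (ball_subset_closedBall hx)) (norm_nonneg _) hC0
    exact mul_le_of_le_one_right hC0 (norm_dcoord_le j)
  have hsum : ∀ x, mssForm (fderiv ℝ F x) (fderiv ℝ h x) (fderiv ℝ φ x) =
      ∑ j, hj j x * mssForm (fderiv ℝ F x) (dcoord j) (fderiv ℝ φ x) := by
    intro x
    conv_lhs => rw [eq_sum_dcoord (fderiv ℝ h x)]
    simp [hjdef]
  simp only [hsum]
  rw [integral_finsetSum _ fun j _ => (hterm j).1, Finset.sum_mul]
  exact (Finset.abs_sum_le_sum_abs _ _).trans (Finset.sum_le_sum fun j _ => (hterm j).2)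

end Defining

section Energy
open Filter Topology Metric

variable {n m : ℕ}

lemma mssForm_comm (P : Eu n →L[ℝ] Eu m) (p q : Eu n →L[ℝ] ℝ) :
    mssForm P p q = mssForm P q p := by
  have hsymm : ((gramMat P)⁻¹).transpose = (gramMat P)⁻¹ := by
    simpa using (gramMat_posDef P).inv.isHermitian.eq
  rw [mssForm_apply, mssForm_apply, Matrix.dotProduct_mulVec, ← Matrix.mulVec_transpose, hsymm,
    dotProduct_comm]

lemma mssForm_defect_eq (P : Eu n →L[ℝ] Eu m) (p q : Eu n →L[ℝ] ℝ) {u b : ℝ} (hb : b ≠ 0)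
    (z z' : ℝ) :
    z * b⁻¹ * mssForm P (p - (b⁻¹ * u) • q) (p - (b⁻¹ * u) • q) =
      mssForm P p ((z * b⁻¹) • p + (u * (z' * b⁻¹ + z * -(b ^ 2)⁻¹)) • q) -
      1 / 2 * mssForm P q ((z * (b ^ 2)⁻¹ * (2 * u)) • p +
        (u ^ 2 * (z' * (b ^ 2)⁻¹ + z * (-(2 * b) / (b ^ 2) ^ 2))) • q) +
      (1 / 2 * (b⁻¹ * u) ^ 2 * z' * mssForm P q q - (b⁻¹ * u) * z' * mssForm P p q) := by
  simp only [map_sub, map_add, map_smul, LinearMap.sub_apply, LinearMap.smul_apply, smul_eq_mul]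
  rw [mssForm_comm P q p]
  field_simp
  ring

/-- The difference quotient of `F` and `H` at the boundary. -/
noncomputable def ratio (F H : Eu n → Eu m) (x : Eu n) : Eu m := (bdf x)⁻¹ • (F x - H x)

/-- The difference between the differential of `F` and that of the extension of the boundary
values by `H + b • ratio`, the ratio being frozen. -/
noncomputable def defect (F H : Eu n → Eu m) (x : Eu n) : Eu n →L[ℝ] Eu m :=
  fderiv ℝ F x - fderiv ℝ H x - (fderiv ℝ bdf x).smulRight (ratio F H x)

lemma dcomp_defect (F H : Eu n → Eu m) (x : Eu n) (α : Fin (m+1)) :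
    dcomp (defect F H x) α = (dcomp (fderiv ℝ F x) α - dcomp (fderiv ℝ H x) α) -
      ((bdf x)⁻¹ * (F x α - H x α)) • fderiv ℝ bdf x := by
  ext v
  simp [defect, ratio, mul_comm]

lemma exists_norm_eq_one_dist_le {x : Eu n} (hx : x ∈ unitBall n) :
    ∃ y : Eu n, ‖y‖ = 1 ∧ dist x y ≤ 1 - ‖x‖ := by
  rcases eq_or_ne x 0 with rfl | h0
  · exact ⟨EuclideanSpace.single 0 1, by simp, by simp⟩
  · have hn := norm_ne_zero_iff.mpr h0
    refine ⟨‖x‖⁻¹ • x, by simp [norm_smul, hn], ?_⟩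
    have hx1 := mem_ball_zero_iff.mp hx
    have e : x - ‖x‖⁻¹ • x = (1 - ‖x‖⁻¹) • x := by rw [sub_smul, one_smul]
    have h1 : 1 ≤ ‖x‖⁻¹ := (one_le_inv₀ (norm_pos_iff.mpr h0)).mpr hx1.le
    rw [dist_eq_norm, e, norm_smul, Real.norm_eq_abs, abs_of_nonpos (by linarith), neg_sub,
      sub_mul, inv_mul_cancel₀ hn, one_mul]

lemma exists_norm_sub_le {F H : Eu n → Eu m} (hF : IsWeakSol F) (hH : ContDiff ℝ 2 H)
    (hbd : ∀ x, ‖x‖ = 1 → F x = H x) :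
    ∃ C, 0 ≤ C ∧ ∀ x ∈ unitBall n, ‖F x - H x‖ ≤ C * bdf x := by
  obtain ⟨K, hK⟩ := hF.exists_lip
  obtain ⟨D, hD⟩ := (hH.of_le one_le_two).contDiffOn.exists_lipschitzOnWith one_ne_zero
    (convex_closedBall (0 : Eu n) 1) (isCompact_closedBall (0 : Eu n) 1)
  refine ⟨K + D, by positivity, fun x hx => ?_⟩
  obtain ⟨y, hy, hxy⟩ := exists_norm_eq_one_dist_le hx
  have h1 := hK.dist_le_mul x y
  have h2 := hD.dist_le_mul x (ball_subset_closedBall hx) y (by simp [hy])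
  have h3 : F x - H x = (F x - F y) - (H x - H y) := by rw [hbd y hy]; abel
  have h4 := hxy.trans (one_sub_norm_le_bdf hx)
  calc ‖F x - H x‖ ≤ dist (F x) (F y) + dist (H x) (H y) := by
        rw [h3, dist_eq_norm, dist_eq_norm]; exact norm_sub_le _ _
    _ ≤ (K + D) * dist x y := by linarith
    _ ≤ _ := by gcongr

lemma contDiff_apply_coord {H : Eu n → Eu m} {k : WithTop ℕ∞} (hH : ContDiff ℝ k H)
    (α : Fin (m+1)) : ContDiff ℝ k fun x => H x α :=
  (dcoord α : Eu m →L[ℝ] ℝ).contDiff.comp hH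

lemma HasFDerivAt.apply_coord {H : Eu n → Eu m} {P : Eu n →L[ℝ] Eu m} {x : Eu n}
    (hH : HasFDerivAt H P x) (α : Fin (m+1)) : HasFDerivAt (fun x => H x α) (dcomp P α) x :=
  (dcoord α : Eu m →L[ℝ] ℝ).hasFDerivAt.comp x hH

lemma IsWeakSol.exists_abs_integral_sub_le {F H : Eu n → Eu m} (hF : IsWeakSol F)
    (hH : ContDiff ℝ 2 H) (α : Fin (m+1)) : ∃ C, 0 ≤ C ∧ ∀ φ : Eu n → ℝ, IsTest φ →
      |∫ x in unitBall n, mssForm (fderiv ℝ F x)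
        (dcomp (fderiv ℝ F x) α - dcomp (fderiv ℝ H x) α) (fderiv ℝ φ x)| ≤
        C * ∫ x in unitBall n, |φ x| := by
  obtain ⟨C, hC0, hC⟩ := hF.exists_abs_integral_le (contDiff_apply_coord hH α)
  obtain ⟨K, hK⟩ := hF.exists_lip
  refine ⟨C, hC0, fun φ hφ => ?_⟩
  obtain ⟨D, hD⟩ := hφ.norm_fderiv_le
  have hd : ∀ x, fderiv ℝ (fun x => H x α) x = dcomp (fderiv ℝ H x) α := fun x =>
    (((hH.differentiable two_ne_zero) x).hasFDerivAt.apply_coord α).fderiv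
  obtain ⟨M, hM⟩ := (isCompact_closedBall (0 : Eu n) 1).exists_bound_of_continuousOn
    ((contDiff_apply_coord hH α).continuous_fderiv two_ne_zero).continuousOn
  have hi1 := integrableOn_mssForm hK (p := fun x => dcomp (fderiv ℝ F x) α) (q := fderiv ℝ φ)
    ((continuous_dcomp α).measurable.comp (measurable_fderiv ℝ F)) (measurable_fderiv _ _)
    (fun x _ => (norm_dcomp_le _ α).trans (norm_fderiv_le_of_lipschitz ℝ hK)) (fun x _ => hD x)
  have hi2 := integrableOn_mssForm hK (p := fderiv ℝ fun x => H x α) (q := fderiv ℝ φ)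
    (measurable_fderiv _ _) (measurable_fderiv _ _)
    (fun x hx => hM x (ball_subset_closedBall hx)) (fun x _ => hD x)
  simp only [← hd, map_sub, LinearMap.sub_apply]
  rw [integral_sub hi1 hi2, hF.fiber φ hφ α, zero_sub, abs_neg]
  exact hC φ hφ

lemma IsTest.integral_abs_le {φ : Eu n → ℝ} (hφ : IsTest φ) {M : ℝ}
    (hM : ∀ x ∈ unitBall n, |φ x| ≤ M) :
    ∫ x in unitBall n, |φ x| ≤ M * volume.real (unitBall n) := by
  calc _ ≤ ∫ _x in unitBall n, M := by
        refine setIntegral_mono_on hφ.integrableOn_abs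
          (integrableOn_const (measure_ball_lt_top.ne)) measurableSet_ball hM
    _ = _ := by rw [setIntegral_const, smul_eq_mul, mul_comm]

/-- The Dirichlet energy of the defect, weighted by the inverse of the defining function, is
bounded. -/
lemma IsWeakSol.exists_energy_le {F H : Eu n → Eu m} (hF : IsWeakSol F) (hH : ContDiff ℝ 2 H)
    (hbd : ∀ x, ‖x‖ = 1 → F x = H x) (α : Fin (m+1)) :
    ∃ C, ∀ δ, 0 < δ → δ ≤ 1 / 2 →
      IntegrableOn (fun x => cutoff δ (bdf x) * (bdf x)⁻¹ *
        mssForm (fderiv ℝ F x) (dcomp (defect F H x) α) (dcomp (defect F H x) α)) (unitBall n) ∧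
      ∫ x in unitBall n, cutoff δ (bdf x) * (bdf x)⁻¹ *
        mssForm (fderiv ℝ F x) (dcomp (defect F H x) α) (dcomp (defect F H x) α) ≤ C := by
  obtain ⟨K, hK⟩ := hF.exists_lip
  obtain ⟨Cu, hCu0, hCu⟩ := exists_norm_sub_le hF hH hbd
  obtain ⟨C1, hC10, hC1⟩ := hF.exists_abs_integral_sub_le hH α
  obtain ⟨C2, hC20, hC2⟩ := hF.exists_abs_integral_le (contDiff_bdf (n := n) (k := 2))
  obtain ⟨Cb, hCb0, hCb⟩ := exists_abs_mssForm_le (n := n) (m := m) K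
  obtain ⟨Cθ, hCθ0, hCθ⟩ := exists_abs_deriv_cutoff_le
  obtain ⟨M, hM⟩ := (isCompact_closedBall (0 : Eu n) 1).exists_bound_of_continuousOn
    ((contDiff_apply_coord hH α).continuous_fderiv two_ne_zero).continuousOn
  have hdH : ∀ x, HasFDerivAt (fun x => H x α) (dcomp (fderiv ℝ H x) α) x := fun x =>
    ((hH.differentiable two_ne_zero) x).hasFDerivAt.apply_coord α
  have hM0 : 0 ≤ M := (norm_nonneg _).trans (hM 0 (by simp))
  set u : Eu n → ℝ := fun x => F x α - H x α with hu
  set du : Eu n → Eu n →L[ℝ] ℝ := fun x => dcomp (fderiv ℝ F x) α - dcomp (fderiv ℝ H x) α with hdu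
  set db : Eu n → Eu n →L[ℝ] ℝ := fun x => fderiv ℝ bdf x with hdb
  set CE : ℝ := 1 / 2 * Cu ^ 2 * (Cb * 2 * 2) + Cu * (Cb * (K + M) * 2) with hCE
  have hCE0 : 0 ≤ CE := by positivity
  have hum : Continuous u := (hK.continuous.sub hH.continuous) |> fun h =>
    (dcoord α : Eu m →L[ℝ] ℝ).continuous.comp h
  have hub : ∀ x ∈ unitBall n, |u x| ≤ Cu * bdf x := fun x hx =>
    (PiLp.norm_apply_le (F x - H x) α).trans (hCu x hx)
  have hdum : Measurable du := by
    exact ((continuous_dcomp α).measurable.comp (measurable_fderiv ℝ F)).sub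
      ((continuous_dcomp α).measurable.comp (measurable_fderiv ℝ H))
  have hdub : ∀ x ∈ unitBall n, ‖du x‖ ≤ K + M := fun x hx => by
    refine (norm_sub_le _ _).trans (add_le_add ?_ ?_)
    · exact (norm_dcomp_le _ α).trans (norm_fderiv_le_of_lipschitz ℝ hK)
    · rw [← (hdH x).fderiv]; exact hM x (ball_subset_closedBall hx)
  have hdbm : Measurable db := measurable_fderiv ℝ _
  have hdbb : ∀ x ∈ unitBall n, ‖db x‖ ≤ 2 := fun x hx =>
    norm_fderiv_bdf_le (mem_ball_zero_iff.mp hx).le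
  refine ⟨C1 * (Cu * volume.real (unitBall n)) + 1 / 2 * (C2 * (Cu ^ 2 * volume.real (unitBall n)))
    + CE * Cθ * (2 * (n + 1) * volume.real (unitBall n)), fun δ hδ hδ' => ?_⟩
  set φ₁ : Eu n → ℝ := fun x => (cutoff δ (bdf x) * (bdf x)⁻¹) * u x with hφ₁
  set φ₂ : Eu n → ℝ := fun x => (cutoff δ (bdf x) * (bdf x ^ 2)⁻¹) * u x ^ 2 with hφ₂
  have hκ₁ : ContDiff ℝ 1 fun x : Eu n => cutoff δ (bdf x) * (bdf x)⁻¹ :=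
    (contDiff_cutoff_mul hδ (g := fun t => t⁻¹) fun t ht => contDiffAt_id.inv ht.ne').comp
      contDiff_bdf
  have hκ₂ : ContDiff ℝ 1 fun x : Eu n => cutoff δ (bdf x) * (bdf x ^ 2)⁻¹ :=
    (contDiff_cutoff_mul hδ (g := fun t => (t ^ 2)⁻¹) fun t ht =>
      (contDiffAt_id.pow 2).inv (pow_ne_zero 2 ht.ne')).comp contDiff_bdf
  have hG : ContDiff ℝ 1 fun z : Eu n × Eu m => z.2 α - H z.1 α :=
    (contDiff_apply_coord contDiff_id α |>.comp contDiff_snd).sub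
      ((contDiff_apply_coord (hH.of_le one_le_two) α).comp contDiff_fst)
  have ht₁ : IsTest φ₁ := isTest_of_contDiff hK
    (G := fun z => (cutoff δ (bdf z.1) * (bdf z.1)⁻¹) * (z.2 α - H z.1 α))
    ((hκ₁.comp contDiff_fst).mul hG) (r := 1 - δ / 2) (by linarith) fun x y hx => by
      simp [cutoff_eq_zero hδ (bdf_le_of_le_norm (by linarith) hx)]
  have ht₂ : IsTest φ₂ := isTest_of_contDiff hK
    (G := fun z => (cutoff δ (bdf z.1) * (bdf z.1 ^ 2)⁻¹) * (z.2 α - H z.1 α) ^ 2)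
    ((hκ₂.comp contDiff_fst).mul (hG.pow 2)) (r := 1 - δ / 2) (by linarith) fun x y hx => by
      simp [cutoff_eq_zero hδ (bdf_le_of_le_norm (by linarith) hx)]
  have hb₁ : ∀ x ∈ unitBall n, |φ₁ x| ≤ Cu := fun x hx => by
    have hb := bdf_pos hx
    rw [hφ₁, abs_mul, abs_mul, abs_of_nonneg (cutoff_nonneg _ _), abs_of_pos (inv_pos.mpr hb)]
    calc _ ≤ 1 * (bdf x)⁻¹ * (Cu * bdf x) := by
          gcongr
          exacts [cutoff_le_one _ _, hub x hx]
      _ = Cu := by field_simp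
  have hb₂ : ∀ x ∈ unitBall n, |φ₂ x| ≤ Cu ^ 2 := fun x hx => by
    have hb := bdf_pos hx
    rw [hφ₂, abs_mul, abs_mul, abs_of_nonneg (cutoff_nonneg _ _), abs_pow,
      abs_of_pos (inv_pos.mpr (pow_pos hb 2))]
    calc _ ≤ 1 * (bdf x ^ 2)⁻¹ * (Cu * bdf x) ^ 2 := by
          gcongr
          exacts [cutoff_le_one _ _, hub x hx]
      _ = Cu ^ 2 := by field_simp
  have hI₁ := (hC1 φ₁ ht₁).trans (mul_le_mul_of_nonneg_left (ht₁.integral_abs_le hb₁) hC10)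
  have hI₂ := (hC2 φ₂ ht₂).trans (mul_le_mul_of_nonneg_left (ht₂.integral_abs_le hb₂) hC20)
  set E : Eu n → ℝ := fun x => 1 / 2 * ((bdf x)⁻¹ * u x) ^ 2 * deriv (cutoff δ) (bdf x) *
    mssForm (fderiv ℝ F x) (db x) (db x) -
    ((bdf x)⁻¹ * u x) * deriv (cutoff δ) (bdf x) * mssForm (fderiv ℝ F x) (du x) (db x) with hE
  have hEm : Measurable E := by
    have h1 : Measurable fun x : Eu n => (bdf x)⁻¹ * u x :=
      (contDiff_bdf (k := 1)).continuous.measurable.inv.mul hum.measurable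
    have h2 : Measurable fun x : Eu n => deriv (cutoff δ) (bdf x) :=
      (((contDiff_cutoff δ).continuous_deriv le_rfl).comp
        (contDiff_bdf (k := 1)).continuous).measurable
    exact ((((h1.pow_const 2).const_mul _).mul h2).mul (measurable_mssForm hdbm hdbm)).sub
      ((h1.mul h2).mul (measurable_mssForm hdum hdbm))
  have hE0 : ∀ x, x ∉ layer n δ → E x = 0 := fun x hx => by
    simp [hE, deriv_cutoff_eq_zero hδ hx]
  have hEb : ∀ x ∈ unitBall n, |E x| ≤ CE * (Cθ / δ) := fun x hx => by
    have hb := bdf_pos hx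
    have h1 : |(bdf x)⁻¹ * u x| ≤ Cu := by
      rw [abs_mul, abs_of_pos (inv_pos.mpr hb), inv_mul_le_iff₀ hb, mul_comm]
      exact hub x hx
    have h2 := hCθ δ hδ (bdf x)
    have hP := norm_fderiv_le_of_lipschitz ℝ hK (x₀ := x)
    have h3 : |mssForm (fderiv ℝ F x) (db x) (db x)| ≤ Cb * 2 * 2 :=
      (hCb _ hP _ _).trans (by gcongr; exacts [hdbb x hx, hdbb x hx])
    have h4 : |mssForm (fderiv ℝ F x) (du x) (db x)| ≤ Cb * (K + M) * 2 :=
      (hCb _ hP _ _).trans (by gcongr; exacts [hdub x hx, hdbb x hx])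
    refine (abs_sub _ _).trans ?_
    rw [abs_mul, abs_mul, abs_mul, abs_pow, abs_mul (_ * _), abs_mul _ (deriv _ _),
      abs_of_pos (one_half_pos (α := ℝ))]
    calc _ ≤ 1 / 2 * Cu ^ 2 * (Cθ / δ) * (Cb * 2 * 2) + Cu * (Cθ / δ) * (Cb * (K + M) * 2) := by
          gcongr
      _ = _ := by rw [hCE]; ring
  have hEi : IntegrableOn E (unitBall n) := integrableOn_of_bounded hEm hEb
  have hIE : ∫ x in unitBall n, E x ≤ CE * Cθ * (2 * (n + 1) * volume.real (unitBall n)) := by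
    have h1 : ∫ x in unitBall n, E x = ∫ x in layer n δ, E x :=
      setIntegral_eq_of_subset_of_forall_sdiff_eq_zero measurableSet_ball (layer_subset hδ)
        fun x hx => hE0 x hx.2
    rw [h1]
    have h2 := norm_setIntegral_le_of_norm_le_const (μ := volume) (s := layer n δ) (f := E)
      (C := CE * (Cθ / δ)) (volume_layer_ne_top hδ).lt_top fun x hx => hEb x (layer_subset hδ hx)
    refine (le_abs_self _).trans (h2.trans ?_)
    calc _ ≤ CE * (Cθ / δ) * (2 * (n + 1) * volume.real (unitBall n) * δ) := by
          gcongr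
          exact volume_layer_le hδ hδ'
      _ = _ := by field_simp
  obtain ⟨D₁, hD₁⟩ := ht₁.norm_fderiv_le
  obtain ⟨D₂, hD₂⟩ := ht₂.norm_fderiv_le
  have hi₁ := integrableOn_mssForm hK hdum (measurable_fderiv ℝ φ₁) hdub fun x _ => hD₁ x
  have hi₂ := integrableOn_mssForm hK hdbm (measurable_fderiv ℝ φ₂) hdbb fun x _ => hD₂ x
  have hae : ∀ᵐ x ∂volume.restrict (unitBall n), cutoff δ (bdf x) * (bdf x)⁻¹ *
        mssForm (fderiv ℝ F x) (dcomp (defect F H x) α) (dcomp (defect F H x) α) =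
      mssForm (fderiv ℝ F x) (du x) (fderiv ℝ φ₁ x) -
      1 / 2 * mssForm (fderiv ℝ F x) (db x) (fderiv ℝ φ₂ x) + E x := by
    rw [ae_restrict_iff' measurableSet_ball]
    filter_upwards [hK.ae_differentiableAt] with x hx hxb
    have hb := (bdf_pos hxb).ne'
    have hux : HasFDerivAt u (du x) x := (hx.hasFDerivAt.apply_coord α).sub (hdH x)
    have hc := hasDerivAt_cutoff δ (bdf x)
    have hd₁ : fderiv ℝ φ₁ x = (cutoff δ (bdf x) * (bdf x)⁻¹) • du x +
        (u x * (deriv (cutoff δ) (bdf x) * (bdf x)⁻¹ +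
          cutoff δ (bdf x) * -(bdf x ^ 2)⁻¹)) • db x := by
      have h := ((hc.mul (hasDerivAt_inv hb)).comp_hasFDerivAt x (hasFDerivAt_bdf x)).mul hux
      rw [smul_smul] at h
      exact h.fderiv
    have hd₂ : fderiv ℝ φ₂ x = (cutoff δ (bdf x) * (bdf x ^ 2)⁻¹ * (2 * u x)) • du x +
        (u x ^ 2 * (deriv (cutoff δ) (bdf x) * (bdf x ^ 2)⁻¹ +
          cutoff δ (bdf x) * (-(2 * bdf x) / (bdf x ^ 2) ^ 2))) • db x := by
      have h := ((hc.mul ((hasDerivAt_pow 2 (bdf x)).inv (pow_ne_zero 2 hb))).comp_hasFDerivAt x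
        (hasFDerivAt_bdf x)).mul (hux.pow 2)
      rw [smul_smul, smul_smul] at h
      refine h.fderiv.trans ?_
      simp [mul_assoc, hdb]
    rw [hd₁, hd₂, dcomp_defect]
    exact mssForm_defect_eq _ _ _ hb _ _
  have hi12 := (hi₁.sub (hi₂.const_mul (1 / 2))).add hEi
  refine ⟨hi12.congr (hae.mono fun x hx => hx.symm), ?_⟩
  rw [integral_congr_ae hae]
  have e1 := integral_add (hi₁.sub (hi₂.const_mul (1 / 2))) hEi
  have e2 := integral_sub hi₁ (hi₂.const_mul (1 / 2))
  simp only [Pi.sub_apply] at e1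
  rw [e1, e2, integral_const_mul]
  have a1 := le_abs_self (∫ x in unitBall n, mssForm (fderiv ℝ F x) (du x) (fderiv ℝ φ₁ x))
  have a2 := neg_abs_le (∫ x in unitBall n, mssForm (fderiv ℝ F x) (db x) (fderiv ℝ φ₂ x))
  linarith

end Energy

section Layer
open Filter Topology Metric

variable {n m : ℕ}

lemma integrableOn_of_cutoff_bounded {f : Eu n → ℝ} (h0 : ∀ x ∈ unitBall n, 0 ≤ f x) {C : ℝ}
    (hf : ∀ δ, 0 < δ → δ ≤ 1 / 2 →
      IntegrableOn (fun x => cutoff δ (bdf x) * f x) (unitBall n) ∧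
      ∫ x in unitBall n, cutoff δ (bdf x) * f x ≤ C) : IntegrableOn f (unitBall n) := by
  set d : ℕ → ℝ := fun k => 1 / ((k : ℝ) + 2) with hd
  have hd0 : ∀ k, 0 < d k := fun k => by positivity
  have hd1 : ∀ k, d k ≤ 1 / 2 := fun k => by
    simp only [hd]
    gcongr
    have : (0 : ℝ) ≤ k := by positivity
    linarith
  have hbm : Measurable (bdf : Eu n → ℝ) := (contDiff_bdf (k := 1)).continuous.measurable
  have hsm : ∀ k, MeasurableSet {x : Eu n | 2 * d k ≤ bdf x} :=
    fun k => measurableSet_le measurable_const hbm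
  have hcov : AECover (volume.restrict (unitBall n)) atTop
      (fun k => {x : Eu n | 2 * d k ≤ bdf x}) := by
    refine ⟨?_, hsm⟩
    refine (ae_restrict_iff' measurableSet_ball).mpr (Eventually.of_forall fun x hx => ?_)
    have h1 : Tendsto (fun k => 2 * d k) atTop (𝓝 0) := by
      have h2 : Tendsto (fun k : ℕ => (k : ℝ) + 2) atTop atTop :=
        tendsto_atTop_add_const_right _ _ tendsto_natCast_atTop_atTop
      have h3 := (h2.inv_tendsto_atTop).const_mul 2
      simp only [mul_zero] at h3
      refine h3.congr fun k => ?_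
      simp [hd]
    exact (h1.eventually_lt_const (bdf_pos hx)).mono fun k hk => le_of_lt hk
  have heq : ∀ k, Set.EqOn (fun x => cutoff (d k) (bdf x) * f x) f {x : Eu n | 2 * d k ≤ bdf x} :=
    fun k x hx => by simp only [cutoff_eq_one (hd0 k) hx, one_mul]
  refine hcov.integrable_of_integral_bounded_of_nonneg_ae C (fun k => ?_) ?_
    (Eventually.of_forall fun k => ?_)
  · exact ((hf _ (hd0 k) (hd1 k)).1.integrableOn).congr_fun (heq k) (hsm k)
  · exact (ae_restrict_iff' measurableSet_ball).mpr (Eventually.of_forall h0)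
  · rw [← setIntegral_congr_fun (hsm k) (heq k)]
    refine le_trans (setIntegral_le_integral (hf _ (hd0 k) (hd1 k)).1 ?_) (hf _ (hd0 k) (hd1 k)).2
    exact (ae_restrict_iff' measurableSet_ball).mpr (Eventually.of_forall fun x hx =>
      mul_nonneg (cutoff_nonneg _ _) (h0 x hx))

lemma exists_setIntegral_layer_le {q : Eu n → ℝ}
    (hi : IntegrableOn (fun x => (bdf x)⁻¹ * q x) (unitBall n)) (hq : ∀ x, 0 ≤ q x)
    (hqi : IntegrableOn q (unitBall n)) {ε : ℝ} (hε : 0 < ε) :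
    ∃ δ₀ > 0, ∀ δ, 0 < δ → δ < δ₀ → ∫ x in layer n δ, q x ≤ ε * δ := by
  have hlay : Tendsto ((volume.restrict (unitBall n)) ∘ layer n) (𝓝[>] 0) (𝓝 0) := by
    have h1 : Tendsto (fun δ : ℝ =>
        ENNReal.ofReal (2 * (n + 1) * volume.real (unitBall n) * δ)) (𝓝[>] 0) (𝓝 0) := by
      have h2 : Tendsto (fun δ : ℝ => 2 * (n + 1) * volume.real (unitBall n) * δ) (𝓝[>] 0) (𝓝 0) :=
        tendsto_nhdsWithin_of_tendsto_nhds ((continuous_const_mul _).tendsto' _ _ (mul_zero _))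
      have h3 := ENNReal.tendsto_ofReal h2
      rwa [ENNReal.ofReal_zero] at h3
    refine tendsto_of_tendsto_of_tendsto_of_le_of_le' tendsto_const_nhds h1
      (Eventually.of_forall fun _ => zero_le) ?_
    have h4 : ∀ᶠ δ : ℝ in 𝓝[>] 0, δ ∈ Set.Ioc (0 : ℝ) (1 / 2) := Ioc_mem_nhdsGT (by norm_num)
    filter_upwards [h4] with δ hδ
    refine (Measure.restrict_apply_le _ _).trans ?_
    rw [ENNReal.le_ofReal_iff_toReal_le (volume_layer_ne_top hδ.1)
      (by have := hδ.1; positivity)]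
    exact volume_layer_le hδ.1 hδ.2
  have ht := hi.tendsto_setIntegral_nhds_zero hlay
  have hev := ht.eventually_lt_const (half_pos hε)
  obtain ⟨δ₀, hδ₀, hsub⟩ := mem_nhdsGT_iff_exists_Ioo_subset.mp hev
  refine ⟨δ₀, hδ₀, fun δ hδ hδ' => ?_⟩
  have h1 : ∫ x in layer n δ, (bdf x)⁻¹ * q x < ε / 2 := by
    have := hsub ⟨hδ, hδ'⟩
    change ∫ x in layer n δ, (bdf x)⁻¹ * q x ∂(volume.restrict (unitBall n)) < ε / 2 at this
    rwa [Measure.restrict_restrict (measurableSet_layer δ),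
      Set.inter_eq_left.mpr (layer_subset hδ)] at this
  have h2 : ∫ x in layer n δ, q x ≤ ∫ x in layer n δ, 2 * δ * ((bdf x)⁻¹ * q x) := by
    refine setIntegral_mono_on (hqi.mono_set (layer_subset hδ))
      ((hi.mono_set (layer_subset hδ)).const_mul _) (measurableSet_layer δ) fun x hx => ?_
    have hb := bdf_pos (layer_subset hδ hx)
    have hq' := hq x
    have h3 : 1 ≤ 2 * δ * (bdf x)⁻¹ := by
      rw [← div_eq_mul_inv, one_le_div hb]
      exact hx.2
    nlinarith
  rw [integral_const_mul] at h2
  nlinarith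

lemma sq_norm_le_sum_dcomp (P : Eu n →L[ℝ] Eu m) : ‖P‖ ^ 2 ≤ ∑ α, ‖dcomp P α‖ ^ 2 := by
  have h0 : 0 ≤ ∑ α, ‖dcomp P α‖ ^ 2 := Finset.sum_nonneg fun _ _ => sq_nonneg _
  have h : ‖P‖ ≤ Real.sqrt (∑ α, ‖dcomp P α‖ ^ 2) := by
    refine P.opNorm_le_bound (Real.sqrt_nonneg _) fun v => ?_
    rw [EuclideanSpace.norm_eq, ← Real.sqrt_sq (norm_nonneg v), ← Real.sqrt_mul h0, Finset.sum_mul]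
    refine Real.sqrt_le_sqrt (Finset.sum_le_sum fun α _ => ?_)
    rw [← mul_pow]
    gcongr
    exact (dcomp P α).le_opNorm v
  calc ‖P‖ ^ 2 ≤ Real.sqrt (∑ α, ‖dcomp P α‖ ^ 2) ^ 2 := by gcongr
    _ = _ := Real.sq_sqrt h0

lemma norm_defect_le {F H : Eu n → Eu m} {K : NNReal} (hK : LipschitzWith K F) {A C : ℝ}
    {x : Eu n} (hx : x ∈ unitBall n) (hA : ‖fderiv ℝ H x‖ ≤ A) (hC : ‖ratio F H x‖ ≤ C) :
    ‖defect F H x‖ ≤ K + A + 2 * C := by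
  have h1 := norm_fderiv_le_of_lipschitz ℝ hK (x₀ := x)
  have h2 := norm_fderiv_bdf_le (mem_ball_zero_iff.mp hx).le
  refine (norm_sub_le _ _).trans (add_le_add ((norm_sub_le _ _).trans (add_le_add h1 hA)) ?_)
  rw [ContinuousLinearMap.norm_smulRight_apply]
  gcongr

lemma norm_ratio_le {F H : Eu n → Eu m} {C : ℝ} {x : Eu n} (hx : x ∈ unitBall n)
    (h : ‖F x - H x‖ ≤ C * bdf x) : ‖ratio F H x‖ ≤ C := by
  have hb := bdf_pos hx
  rw [ratio, norm_smul, norm_inv, Real.norm_of_nonneg hb.le, inv_mul_le_iff₀ hb, mul_comm]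
  exact h

lemma measurable_defect {F H : Eu n → Eu m} (hF : Continuous F) (hH : Continuous H) :
    Measurable (defect F H) := by
  have hbm : Measurable (bdf : Eu n → ℝ) := (contDiff_bdf (k := 1)).continuous.measurable
  have h1 : Measurable (ratio F H) := hbm.inv.smul (hF.measurable.sub hH.measurable)
  have h2 : Continuous fun z : (Eu n →L[ℝ] ℝ) × Eu m => z.1.smulRight z.2 := by fun_prop
  exact ((measurable_fderiv ℝ F).sub (measurable_fderiv ℝ H)).sub
    (h2.measurable.comp ((measurable_fderiv ℝ bdf).prodMk h1))

lemma IsWeakSol.exists_defect_layer_le {F H : Eu n → Eu m} (hF : IsWeakSol F)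
    (hH : ContDiff ℝ 2 H) (hbd : ∀ x, ‖x‖ = 1 → F x = H x) {ε : ℝ} (hε : 0 < ε) :
    IntegrableOn (fun x => ‖defect F H x‖ ^ 2) (unitBall n) ∧
    ∃ δ₀ > 0, ∀ δ, 0 < δ → δ < δ₀ → ∫ x in layer n δ, ‖defect F H x‖ ^ 2 ≤ ε * δ := by
  obtain ⟨K, hK⟩ := hF.exists_lip
  obtain ⟨C, hC0, hC⟩ := exists_norm_sub_le hF hH hbd
  obtain ⟨c, hc, hcb⟩ := exists_le_mssForm (n := n) (m := m) K.coe_nonneg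
  have hH1 : Continuous (fderiv ℝ H) := hH.continuous_fderiv two_ne_zero
  obtain ⟨A, hA⟩ := (isCompact_closedBall (0 : Eu n) 1).exists_bound_of_continuousOn
    hH1.continuousOn
  have hmd := measurable_defect hK.continuous hH.continuous
  have hbm : Measurable (bdf : Eu n → ℝ) := (contDiff_bdf (k := 1)).continuous.measurable
  have hqi : IntegrableOn (fun x => ‖defect F H x‖ ^ 2) (unitBall n) := by
    refine integrableOn_of_bounded (hmd.norm.pow_const 2) (C := (K + A + 2 * C) ^ 2) fun x hx => ?_
    rw [abs_of_nonneg (sq_nonneg _)]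
    gcongr
    exact norm_defect_le hK hx (hA x (ball_subset_closedBall hx)) (norm_ratio_le hx (hC x hx))
  refine ⟨hqi, exists_setIntegral_layer_le ?_ (fun x => sq_nonneg _) hqi hε⟩
  have hα : ∀ α, IntegrableOn (fun x => (bdf x)⁻¹ *
      mssForm (fderiv ℝ F x) (dcomp (defect F H x) α) (dcomp (defect F H x) α)) (unitBall n) := by
    intro α
    obtain ⟨I, hI⟩ := hF.exists_energy_le hH hbd α
    refine integrableOn_of_cutoff_bounded (C := I) (fun x hx => ?_) fun δ hδ hδ' => ?_
    · have h1 := hcb _ (norm_fderiv_le_of_lipschitz ℝ hK (x₀ := x)) (dcomp (defect F H x) α)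
      have h2 := bdf_pos hx
      exact mul_nonneg (inv_pos.mpr h2).le (le_trans (by positivity) h1)
    · simp only [← mul_assoc]
      exact hI δ hδ hδ'
  have hsum : IntegrableOn (fun x => c⁻¹ * ∑ α, (bdf x)⁻¹ *
      mssForm (fderiv ℝ F x) (dcomp (defect F H x) α) (dcomp (defect F H x) α)) (unitBall n) :=
    (integrable_finsetSum _ fun α _ => hα α).const_mul _
  refine hsum.mono' (hbm.inv.mul (hmd.norm.pow_const 2)).aestronglyMeasurable
    ((ae_restrict_iff' measurableSet_ball).mpr (Eventually.of_forall fun x hx => ?_))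
  have h2 := bdf_pos hx
  rw [Real.norm_of_nonneg (by positivity), ← Finset.mul_sum, ← mul_assoc, mul_comm c⁻¹, mul_assoc]
  refine mul_le_mul_of_nonneg_left ?_ (inv_pos.mpr h2).le
  rw [inv_mul_eq_div, le_div_iff₀ hc, mul_comm]
  calc c * ‖defect F H x‖ ^ 2 ≤ c * ∑ α, ‖dcomp (defect F H x) α‖ ^ 2 := by
        gcongr; exact sq_norm_le_sum_dcomp _
    _ = ∑ α, c * ‖dcomp (defect F H x) α‖ ^ 2 := Finset.mul_sum _ _ _
    _ ≤ _ := Finset.sum_le_sum fun α _ => hcb _ (norm_fderiv_le_of_lipschitz ℝ hK) _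

lemma exists_sliceDens_le (K : ℝ) : ∃ M, 0 ≤ M ∧ ∀ P : Eu n →L[ℝ] Eu m, ‖P‖ ≤ K →
    ∀ p : Eu n →L[ℝ] ℝ, ‖p‖ ≤ 2 → sliceDens P p ≤ M := by
  obtain ⟨M, hM⟩ := ((isCompact_closedBall (0 : Eu n →L[ℝ] Eu m) K).prod
    (isCompact_closedBall (0 : Eu n →L[ℝ] ℝ) 2)).exists_bound_of_continuousOn
    (f := fun x => sliceDens x.1 x.2) continuous_sliceDens.continuousOn
  refine ⟨max M 0, le_max_right _ _, fun P hP p hp => ?_⟩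
  exact (le_abs_self _).trans ((hM (P, p) (by simp [hP, hp])).trans (le_max_left _ _))

/-- Near the sphere the conormal derivative is controlled by the tangential part of the boundary
values, up to an arbitrarily small error in mean. -/
lemma IsWeakSol.exists_sliceDens_layer_le {F H : Eu n → Eu m} (hF : IsWeakSol F)
    (hH : ContDiff ℝ 2 H) (hbd : ∀ x, ‖x‖ = 1 → F x = H x) {l : ℕ} {A : ℝ}
    (hrank : ∀ x, ‖x‖ = 1 →
      Module.finrank ℝ (LinearMap.range (fderiv ℝ H x : Eu n →ₗ[ℝ] Eu m)) ≤ l)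
    (hA : ∀ x, ‖x‖ = 1 → ‖fderiv ℝ H x‖ ≤ A) :
    ∃ δ₀ > 0, ∀ δ, 0 < δ → δ < δ₀ →
      ∫ x in layer n δ, sliceDens (fderiv ℝ F x) (fderiv ℝ bdf x) ≤
        ((n + 1) * 4 * (1 + (n + 1) * A ^ 2) ^ l + 1) * volume.real (layer n δ) + δ := by
  obtain ⟨K, hK⟩ := hF.exists_lip
  obtain ⟨C, hC0, hC⟩ := exists_norm_sub_le hF hH hbd
  set M₀ : ℝ := (n + 1) * 4 * (1 + (n + 1) * A ^ 2) ^ l with hM₀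
  have hH1 : Continuous (fderiv ℝ H) := hH.continuous_fderiv two_ne_zero
  have hb1 : Continuous (fderiv ℝ (bdf : Eu n → ℝ)) :=
    (contDiff_bdf (k := 1)).continuous_fderiv one_ne_zero
  set Ψ : Eu n × Eu m × (Eu n →L[ℝ] Eu m) → ℝ := fun z =>
    sliceDens (fderiv ℝ H z.1 + (fderiv ℝ bdf z.1).smulRight z.2.1 + z.2.2) (fderiv ℝ bdf z.1)
    with hΨ
  have hΨc : Continuous Ψ := by
    have h2 : Continuous fun z : (Eu n →L[ℝ] ℝ) × Eu m => z.1.smulRight z.2 := by fun_prop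
    have hb2 : Continuous fun z : Eu n × Eu m × (Eu n →L[ℝ] Eu m) => fderiv ℝ bdf z.1 :=
      hb1.comp continuous_fst
    exact continuous_sliceDens.comp ((((hH1.comp continuous_fst).add
      (h2.comp (hb2.prodMk (continuous_fst.comp continuous_snd)))).add
      (continuous_snd.comp continuous_snd)).prodMk hb2)
  obtain ⟨τ, hτ, hτs⟩ := ((isCompact_sphere (0 : Eu n) 1).prod
    ((isCompact_closedBall (0 : Eu m) C).prod
      (isCompact_singleton (x := (0 : Eu n →L[ℝ] Eu m))))).exists_thickening_subset_open
    (isOpen_lt hΨc (continuous_const (y := M₀ + 1))) (by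
      rintro ⟨x, v, w⟩ ⟨hx, -, hw⟩
      have hx1 : ‖x‖ = 1 := by simpa using hx
      obtain rfl : w = 0 := hw
      change sliceDens (fderiv ℝ H x + (fderiv ℝ bdf x).smulRight v + 0) (fderiv ℝ bdf x) < M₀ + 1
      rw [add_zero]
      refine lt_of_le_of_lt (sliceDens_add_smulRight_le _ l (hrank x hx1) _ v) ?_
      refine lt_of_le_of_lt ?_ (lt_add_one _)
      have h1 := norm_fderiv_bdf_le hx1.le
      have h2 := hA x hx1
      calc _ ≤ ((n : ℝ) + 1) * 2 ^ 2 * (1 + (n + 1) * A ^ 2) ^ l := by gcongr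
        _ = M₀ := by rw [hM₀]; norm_num)
  obtain ⟨M₁, hM₁0, hM₁⟩ := exists_sliceDens_le (n := n) (m := m) K
  have hε : 0 < τ ^ 2 / (M₁ + 1) := by positivity
  obtain ⟨hwi, δ₁, hδ₁, hδw⟩ := hF.exists_defect_layer_le hH hbd hε
  have hM₀0 : 0 ≤ M₀ := by positivity
  refine ⟨min δ₁ (τ / 2), by positivity, fun δ hδ hδ' => ?_⟩
  have hδτ : 2 * δ < τ := by
    have := hδ'.trans_le (min_le_right _ _)
    linarith
  have hlay := layer_subset (n := n) hδ
  have hsm : Measurable fun x => sliceDens (fderiv ℝ F x) (fderiv ℝ bdf x) :=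
    continuous_sliceDens.measurable.comp ((measurable_fderiv ℝ F).prodMk (measurable_fderiv ℝ bdf))
  have hM₁' : ∀ x ∈ unitBall n, sliceDens (fderiv ℝ F x) (fderiv ℝ bdf x) ≤ M₁ := fun x hx =>
    hM₁ _ (norm_fderiv_le_of_lipschitz ℝ hK) _ (norm_fderiv_bdf_le (mem_ball_zero_iff.mp hx).le)
  have hsi : IntegrableOn (fun x => sliceDens (fderiv ℝ F x) (fderiv ℝ bdf x)) (unitBall n) :=
    integrableOn_of_bounded hsm fun x hx => by
      rw [abs_of_nonneg (sliceDens_nonneg _ _)]; exact hM₁' x hx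
  have hpt : ∀ x ∈ layer n δ, sliceDens (fderiv ℝ F x) (fderiv ℝ bdf x) ≤
      (M₀ + 1) + M₁ / τ ^ 2 * ‖defect F H x‖ ^ 2 := by
    intro x hx
    have hxb := hlay hx
    by_cases hw : ‖defect F H x‖ < τ
    · obtain ⟨y, hy, hxy⟩ := exists_norm_eq_one_dist_le hxb
      have hxτ : dist x y < τ := by
        have := one_sub_norm_le_bdf hxb
        linarith [hx.2]
      have hmem : (x, ratio F H x, defect F H x) ∈ {z | Ψ z < M₀ + 1} := by
        refine hτs (mem_thickening_iff.mpr ⟨(y, ratio F H x, 0), ⟨by simp [hy],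
          by simpa using norm_ratio_le hxb (hC x hxb), rfl⟩, ?_⟩)
        rw [Prod.dist_eq, Prod.dist_eq]
        simp [hxτ, hw]
      have h1 : sliceDens (fderiv ℝ H x + (fderiv ℝ bdf x).smulRight (ratio F H x) +
        defect F H x) (fderiv ℝ bdf x) < M₀ + 1 := hmem
      rw [show fderiv ℝ H x + (fderiv ℝ bdf x).smulRight (ratio F H x) + defect F H x =
        fderiv ℝ F x by rw [defect]; abel] at h1
      have : 0 ≤ M₁ / τ ^ 2 * ‖defect F H x‖ ^ 2 := by positivity
      linarith
    · push Not at hw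
      have h1 := hM₁' x hxb
      have h2 : M₁ ≤ M₁ / τ ^ 2 * ‖defect F H x‖ ^ 2 := by
        rw [div_mul_eq_mul_div, le_div_iff₀ (by positivity)]
        gcongr
      linarith
  have hci : IntegrableOn (fun _ : Eu n => M₀ + 1) (layer n δ) :=
    integrableOn_const (volume_layer_ne_top hδ)
  have hwi' := (hwi.mono_set hlay).const_mul (M₁ / τ ^ 2)
  calc _ ≤ ∫ x in layer n δ, ((M₀ + 1) + M₁ / τ ^ 2 * ‖defect F H x‖ ^ 2) :=
        setIntegral_mono_on (hsi.mono_set hlay) (hci.add hwi') (measurableSet_layer δ) hpt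
    _ = (M₀ + 1) * volume.real (layer n δ) +
        M₁ / τ ^ 2 * ∫ x in layer n δ, ‖defect F H x‖ ^ 2 := by
        rw [integral_add hci hwi', setIntegral_const, integral_const_mul, smul_eq_mul, mul_comm]
    _ ≤ (M₀ + 1) * volume.real (layer n δ) + M₁ / τ ^ 2 * (τ ^ 2 / (M₁ + 1) * δ) := by
        gcongr
        exact hδw δ hδ (hδ'.trans_le (min_le_left _ _))
    _ ≤ _ := by
        gcongr
        have : M₁ / τ ^ 2 * (τ ^ 2 / (M₁ + 1) * δ) = M₁ / (M₁ + 1) * δ := by field_simp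
        rw [this]
        have h3 : M₁ / (M₁ + 1) ≤ 1 := by rw [div_le_one (by linarith)]; linarith
        nlinarith

end Layer

section Monotonicity
open Filter Topology Metric

variable {n m : ℕ}

lemma measurable_sliceDens_fderiv (F : Eu n → Eu m) :
    Measurable fun x => sliceDens (fderiv ℝ F x) (fderiv ℝ bdf x) :=
  continuous_sliceDens.measurable.comp ((measurable_fderiv ℝ F).prodMk (measurable_fderiv ℝ bdf))

lemma integrableOn_sliceDens {F : Eu n → Eu m} {K : NNReal} (hK : LipschitzWith K F) :
    IntegrableOn (fun x => sliceDens (fderiv ℝ F x) (fderiv ℝ bdf x)) (unitBall n) := by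
  obtain ⟨M, -, hM⟩ := exists_sliceDens_le (n := n) (m := m) K
  refine integrableOn_of_bounded (measurable_sliceDens_fderiv F) (C := M) fun x hx => ?_
  rw [abs_of_nonneg (sliceDens_nonneg _ _)]
  exact hM _ (norm_fderiv_le_of_lipschitz ℝ hK) _
    (norm_fderiv_bdf_le (mem_ball_zero_iff.mp hx).le)

lemma sqrt_le_half_add {a T : ℝ} (ha : 0 ≤ a) (hT : 0 < T) :
    Real.sqrt a ≤ (2 * T)⁻¹ * a + T / 2 := by
  have h1 := Real.sq_sqrt ha
  have h2 := sq_nonneg (Real.sqrt a - T)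
  have h3 : (2 * T)⁻¹ * a + T / 2 - Real.sqrt a = (2 * T)⁻¹ * (Real.sqrt a - T) ^ 2 := by
    rw [sub_sq, h1]; field_simp; ring
  have h4 : 0 ≤ (2 * T)⁻¹ * (Real.sqrt a - T) ^ 2 := by positivity
  linarith

lemma integrableOn_sqrt_sliceDens {F : Eu n → Eu m} {K : NNReal} (hK : LipschitzWith K F) :
    IntegrableOn (fun x => Real.sqrt (sliceDens (fderiv ℝ F x) (fderiv ℝ bdf x)))
      (unitBall n) := by
  refine (((integrableOn_sliceDens hK).const_mul (2 * 1)⁻¹).add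
    (integrableOn_const (C := (1 : ℝ) / 2) measure_ball_lt_top.ne)).mono'
    (measurable_sliceDens_fderiv F).sqrt.aestronglyMeasurable (Eventually.of_forall fun x => ?_)
  rw [Real.norm_of_nonneg (Real.sqrt_nonneg _)]
  exact sqrt_le_half_add (sliceDens_nonneg _ _) one_pos

lemma setIntegral_sqrt_sliceDens_le {F : Eu n → Eu m} {K : NNReal} (hK : LipschitzWith K F)
    {δ M T : ℝ} (hM : 0 ≤ M) (hT : 0 < T) (hδ : 0 < δ) (hδ' : δ ≤ 1 / 2)
    (h : ∫ x in layer n δ, sliceDens (fderiv ℝ F x) (fderiv ℝ bdf x) ≤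
      M * volume.real (layer n δ) + δ) :
    ∫ x in layer n δ, Real.sqrt (sliceDens (fderiv ℝ F x) (fderiv ℝ bdf x)) ≤
      ((2 * T)⁻¹ * (M * (2 * (n + 1) * volume.real (unitBall n)) + 1) +
        T / 2 * (2 * (n + 1) * volume.real (unitBall n))) * δ := by
  have hlay := layer_subset (n := n) hδ
  have h1 := ((integrableOn_sliceDens hK).mono_set hlay).const_mul (2 * T)⁻¹
  have h2 : IntegrableOn (fun _ : Eu n => T / 2) (layer n δ) :=
    integrableOn_const (volume_layer_ne_top hδ)
  have hv := volume_layer_le (n := n) hδ hδ'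
  calc _ ≤ ∫ x in layer n δ, ((2 * T)⁻¹ * sliceDens (fderiv ℝ F x) (fderiv ℝ bdf x) + T / 2) :=
        setIntegral_mono_on ((integrableOn_sqrt_sliceDens hK).mono_set hlay) (h1.add h2)
          (measurableSet_layer δ) fun x _ => sqrt_le_half_add (sliceDens_nonneg _ _) hT
    _ = (2 * T)⁻¹ * (∫ x in layer n δ, sliceDens (fderiv ℝ F x) (fderiv ℝ bdf x)) +
        T / 2 * volume.real (layer n δ) := by
        rw [integral_add h1 h2, setIntegral_const, integral_const_mul, smul_eq_mul,
          mul_comm (volume.real _)]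
    _ ≤ (2 * T)⁻¹ * (M * (2 * (n + 1) * volume.real (unitBall n) * δ) + δ) +
        T / 2 * (2 * (n + 1) * volume.real (unitBall n) * δ) := by
        gcongr
        exact h.trans (by gcongr)
    _ = _ := by ring

/-- Half the differential of the squared distance in the graph is `dhalf`. -/
lemma hasFDerivAt_norm_sq_sub {F : Eu n → Eu m} {x : Eu n} (hx : DifferentiableAt ℝ F x)
    (x₀ : Eu n) (y₀ : Eu m) :
    HasFDerivAt (fun x => ‖x - x₀‖ ^ 2 + ‖F x - y₀‖ ^ 2)
      ((2 : ℝ) • dhalf (fderiv ℝ F x) (x - x₀) (F x - y₀)) x := by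
  have h1 : ∀ j ∈ Finset.univ, HasFDerivAt (fun x : Eu n => (x j - x₀ j) ^ 2)
      ((2 * (x j - x₀ j)) • dcoord j) x := fun j _ => by
    have h := ((dcoord j : Eu n →L[ℝ] ℝ).hasFDerivAt (x := x)).sub_const (x₀ j)
    have h' := h.pow 2
    have e : (2 • (dcoord j x - x₀ j) ^ (2 - 1)) • (dcoord j : Eu n →L[ℝ] ℝ) =
      (2 * (x j - x₀ j)) • dcoord j := by simp
    exact e ▸ h'
  have h2 : ∀ α ∈ Finset.univ, HasFDerivAt (fun x : Eu n => (F x α - y₀ α) ^ 2)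
      ((2 * (F x α - y₀ α)) • dcomp (fderiv ℝ F x) α) x := fun α _ => by
    have h := (hx.hasFDerivAt.apply_coord α).sub_const (y₀ α)
    have h' := h.pow 2
    have e : (2 • (F x α - y₀ α) ^ (2 - 1)) • dcomp (fderiv ℝ F x) α =
      (2 * (F x α - y₀ α)) • dcomp (fderiv ℝ F x) α := by simp
    exact e ▸ h'
  have h3 := (HasFDerivAt.fun_sum h1).add (HasFDerivAt.fun_sum h2)
  have e1 : (fun x => ‖x - x₀‖ ^ 2 + ‖F x - y₀‖ ^ 2) =
      (fun x => ∑ j, (x j - x₀ j) ^ 2) + fun x => ∑ α, (F x α - y₀ α) ^ 2 := by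
    funext x
    simp [EuclideanSpace.real_norm_sq_eq]
  have e2 : (2 : ℝ) • dhalf (fderiv ℝ F x) (x - x₀) (F x - y₀) =
      ∑ j, (2 * (x j - x₀ j)) • dcoord j + ∑ α, (2 * (F x α - y₀ α)) • dcomp (fderiv ℝ F x) α := by
    simp [dhalf, Finset.smul_sum, smul_smul]
  rw [e1, e2]
  exact h3

lemma sum_mssForm_add (P : Eu n →L[ℝ] Eu m) (y : Eu n) (z : Eu m) (a : ℝ)
    (w : Eu n →L[ℝ] ℝ) :
    ∑ j, mssForm P (dcoord j) (a • dcoord j + y j • w) +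
      ∑ α, mssForm P (dcomp P α) (a • dcomp P α + z α • w) =
    a * ((n + 1) * volDens P) + mssForm P (dhalf P y z) w := by
  rw [← sum_mssForm, dhalf]
  simp only [map_add, map_smul, map_sum, LinearMap.add_apply, LinearMap.sum_apply,
    LinearMap.smul_apply, smul_eq_mul, Finset.sum_add_distrib, mul_add, Finset.mul_sum]
  ring

lemma IsWeakSol.integral_radial_eq_zero {F : Eu n → Eu m} (hF : IsWeakSol F) (x₀ : Eu n)
    (y₀ : Eu m) {g : Eu n × Eu m → ℝ} (hg : ContDiff ℝ 1 g) {r : ℝ} (hr : r < 1)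
    (hg0 : ∀ x y, r ≤ ‖x‖ → g (x, y) = 0) :
    IntegrableOn (fun x => g (x, F x) * ((n + 1) * volDens (fderiv ℝ F x)) +
      mssForm (fderiv ℝ F x) (dhalf (fderiv ℝ F x) (x - x₀) (F x - y₀))
        (fderiv ℝ (fun x => g (x, F x)) x)) (unitBall n) ∧
    ∫ x in unitBall n, (g (x, F x) * ((n + 1) * volDens (fderiv ℝ F x)) +
      mssForm (fderiv ℝ F x) (dhalf (fderiv ℝ F x) (x - x₀) (F x - y₀))
        (fderiv ℝ (fun x => g (x, F x)) x)) = 0 := by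
  obtain ⟨K, hK⟩ := hF.exists_lip
  set a : Eu n → ℝ := fun x => g (x, F x) with ha
  set φ : Fin (n+1) → Eu n → ℝ := fun j x => a x * (x j - x₀ j) with hφ
  set χ : Fin (m+1) → Eu n → ℝ := fun α x => a x * (F x α - y₀ α) with hχ
  have ht : ∀ j, IsTest (φ j) := fun j => by
    have hG : ContDiff ℝ 1 fun z : Eu n × Eu m => g z * (z.1 j - x₀ j) :=
      hg.mul (((dcoord j : Eu n →L[ℝ] ℝ).contDiff.comp contDiff_fst).sub contDiff_const)
    exact isTest_of_contDiff hK hG hr fun x y hx => by simp [hg0 x y hx]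
  have ht' : ∀ α, IsTest (χ α) := fun α => by
    have hG : ContDiff ℝ 1 fun z : Eu n × Eu m => g z * (z.2 α - y₀ α) :=
      hg.mul (((dcoord α : Eu m →L[ℝ] ℝ).contDiff.comp contDiff_snd).sub contDiff_const)
    exact isTest_of_contDiff hK hG hr fun x y hx => by simp [hg0 x y hx]
  have hi : ∀ j, IntegrableOn (fun x => mssForm (fderiv ℝ F x) (dcoord j) (fderiv ℝ (φ j) x))
      (unitBall n) := fun j => by
    obtain ⟨D, hD⟩ := (ht j).norm_fderiv_le
    exact integrableOn_mssForm hK measurable_const (measurable_fderiv ℝ _)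
      (fun _ _ => norm_dcoord_le j) fun x _ => hD x
  have hi' : ∀ α, IntegrableOn (fun x => mssForm (fderiv ℝ F x) (dcomp (fderiv ℝ F x) α)
      (fderiv ℝ (χ α) x)) (unitBall n) := fun α => by
    obtain ⟨D, hD⟩ := (ht' α).norm_fderiv_le
    exact integrableOn_mssForm hK ((continuous_dcomp α).measurable.comp (measurable_fderiv ℝ F))
      (measurable_fderiv ℝ _)
      (fun _ _ => (norm_dcomp_le _ α).trans (norm_fderiv_le_of_lipschitz ℝ hK)) fun x _ => hD x
  have hs := integrable_finsetSum Finset.univ fun j _ => hi j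
  have hs' := integrable_finsetSum Finset.univ fun α _ => hi' α
  have hae : ∀ᵐ x ∂volume.restrict (unitBall n),
      ∑ j, mssForm (fderiv ℝ F x) (dcoord j) (fderiv ℝ (φ j) x) +
        ∑ α, mssForm (fderiv ℝ F x) (dcomp (fderiv ℝ F x) α) (fderiv ℝ (χ α) x) =
      a x * ((n + 1) * volDens (fderiv ℝ F x)) +
      mssForm (fderiv ℝ F x) (dhalf (fderiv ℝ F x) (x - x₀) (F x - y₀)) (fderiv ℝ a x) := by
    refine ae_restrict_of_ae ?_
    filter_upwards [hK.ae_differentiableAt] with x hx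
    have hax : HasFDerivAt a (fderiv ℝ a x) x :=
      ((hg.differentiable one_ne_zero _).comp x (differentiableAt_id.prodMk hx)).hasFDerivAt
    rw [← sum_mssForm_add]
    congr 1
    · refine Finset.sum_congr rfl fun j _ => ?_
      congr 1
      have h := hax.mul (((dcoord j : Eu n →L[ℝ] ℝ).hasFDerivAt (x := x)).sub_const (x₀ j))
      exact h.fderiv
    · refine Finset.sum_congr rfl fun α _ => ?_
      congr 1
      have h := hax.mul ((hx.hasFDerivAt.apply_coord α).sub_const (y₀ α))
      exact h.fderiv
  refine ⟨(hs.add hs').congr hae, ?_⟩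
  rw [← integral_congr_ae hae, integral_add hs hs', integral_finsetSum _ fun j _ => hi j,
    integral_finsetSum _ fun α _ => hi' α]
  simp [hF.base _ (ht _), hF.fiber _ (ht' _)]

end Monotonicity

section MonotonicityInequality
open Filter Topology Metric

variable {n m : ℕ}

lemma volDens_nonneg (P : Eu n →L[ℝ] Eu m) : 0 ≤ volDens P := Real.sqrt_nonneg _

lemma integrableOn_volDens {F : Eu n → Eu m} {K : NNReal} (hK : LipschitzWith K F) :
    IntegrableOn (fun x => volDens (fderiv ℝ F x)) (unitBall n) := by
  obtain ⟨M, hM⟩ := (isCompact_closedBall (0 : Eu n →L[ℝ] Eu m) K).exists_bound_of_continuousOn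
    continuous_volDens.continuousOn
  refine integrableOn_of_bounded (continuous_volDens.measurable.comp (measurable_fderiv ℝ F))
    (C := M) fun x _ => hM _ ?_
  simpa using norm_fderiv_le_of_lipschitz ℝ hK (x₀ := x)

lemma rpow_mul_sqrt_le {t S r : ℝ} (hr : 0 < r) (hS : 0 ≤ S) (ht : r ^ 2 ≤ t) (n : ℕ) :
    (t + S) ^ (-(((n : ℝ) + 1) / 2)) * Real.sqrt t ≤ (r ^ n)⁻¹ := by
  have ht0 : 0 < t := lt_of_lt_of_le (by positivity) ht
  have h1 : (t + S) ^ (-(((n : ℝ) + 1) / 2)) ≤ t ^ (-(((n : ℝ) + 1) / 2)) :=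
    Real.rpow_le_rpow_of_nonpos ht0 (by linarith) (by have := n.cast_nonneg (α := ℝ); linarith)
  calc _ ≤ t ^ (-(((n : ℝ) + 1) / 2)) * t ^ ((1 : ℝ) / 2) := by
        rw [← Real.sqrt_eq_rpow]; gcongr
    _ = t ^ (-((n : ℝ) / 2)) := by rw [← Real.rpow_add ht0]; congr 1; ring
    _ ≤ (r ^ 2) ^ (-((n : ℝ) / 2)) :=
        Real.rpow_le_rpow_of_nonpos (by positivity) ht
          (by have := n.cast_nonneg (α := ℝ); linarith)
    _ = (r ^ n)⁻¹ := by
        rw [← Real.rpow_natCast, ← Real.rpow_mul hr.le, ← Real.rpow_natCast, ← Real.rpow_neg hr.le]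
        congr 1; push_cast; ring

/-- A monotonicity inequality: the area of the graph near an interior point is controlled by the
conormal flux through a thin shell near the boundary. -/
lemma IsWeakSol.area_le_flux {F : Eu n → Eu m} (hF : IsWeakSol F) (x₀ : Eu n) {s r δ C Λ : ℝ}
    (hs : 0 < s) (hr : 0 < r) (hδ : 0 < δ) (hδ1 : δ ≤ 1) (hC0 : 0 ≤ C)
    (hC : ∀ t, |deriv (cutoff δ) t| ≤ C / δ)
    (hJ : ∫ x in layer n δ, Real.sqrt (sliceDens (fderiv ℝ F x) (fderiv ℝ bdf x)) ≤ Λ * δ)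
    (hrx : ∀ x ∈ layer n δ, r ^ 2 ≤ ‖x - x₀‖ ^ 2 + ‖F x - F x₀‖ ^ 2)
    {D : Set (Eu n)} (hDm : MeasurableSet D) (hDb : D ⊆ unitBall n)
    (hD : ∀ x ∈ D, 2 * δ ≤ bdf x ∧ ‖x - x₀‖ ^ 2 + ‖F x - F x₀‖ ^ 2 < s ^ 2) :
    (n + 1) * (s ^ 2 * (2 * s ^ 2) ^ (-(((n : ℝ) + 1) / 2) - 1)) *
      ∫ x in D, volDens (fderiv ℝ F x) ≤ C * Λ * (r ^ n)⁻¹ := by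
  obtain ⟨K, hK⟩ := hF.exists_lip
  set e : ℝ := -(((n : ℝ) + 1) / 2) with he
  have hn0 : (0 : ℝ) ≤ n := n.cast_nonneg
  have he0 : e - 1 ≤ 0 := by rw [he]; linarith
  set τ : Eu n → ℝ := fun x => ‖x - x₀‖ ^ 2 + ‖F x - F x₀‖ ^ 2 with hτ
  have hS : 0 < s ^ 2 := by positivity
  have hτ0 : ∀ x, 0 ≤ τ x := fun x => by positivity
  set g : Eu n × Eu m → ℝ := fun z =>
    cutoff δ (bdf z.1) * (‖z.1 - x₀‖ ^ 2 + ‖z.2 - F x₀‖ ^ 2 + s ^ 2) ^ e with hgdef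
  have hg : ContDiff ℝ 1 g := by
    have h1 : ContDiff ℝ 1 fun z : Eu n × Eu m => cutoff δ (bdf z.1) :=
      (contDiff_cutoff δ).comp (contDiff_bdf.comp contDiff_fst)
    have h2 : ContDiff ℝ 1 fun z : Eu n × Eu m => ‖z.1 - x₀‖ ^ 2 + ‖z.2 - F x₀‖ ^ 2 + s ^ 2 :=
      (((contDiff_fst.sub contDiff_const).norm_sq ℝ).add
        ((contDiff_snd.sub contDiff_const).norm_sq ℝ)).add contDiff_const
    exact h1.mul (h2.rpow_const_of_ne fun z => by positivity)
  have hg0 : ∀ x y, 1 - δ / 2 ≤ ‖x‖ → g (x, y) = 0 := fun x y hx => by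
    simp [hgdef, cutoff_eq_zero hδ (bdf_le_of_le_norm hδ1 hx)]
  obtain ⟨hI, hI0⟩ := hF.integral_radial_eq_zero x₀ (F x₀) hg (by linarith) hg0
  set c : ℝ := (n + 1) * (s ^ 2 * (2 * s ^ 2) ^ (e - 1)) with hc
  set J : Eu n → ℝ := fun x => Real.sqrt (sliceDens (fderiv ℝ F x) (fderiv ℝ bdf x)) with hJdef
  have hlay := layer_subset (n := n) hδ
  have hVi := ((integrableOn_volDens hK).mono_set hDb).const_mul c
  have hJi := ((integrableOn_sqrt_sliceDens hK).mono_set hlay).const_mul (C / δ * (r ^ n)⁻¹)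
  have hVi' : IntegrableOn (D.indicator fun x => c * volDens (fderiv ℝ F x)) (unitBall n) :=
    (IntegrableOn.integrable_indicator hVi hDm).integrableOn
  have hJi' : IntegrableOn ((layer n δ).indicator fun x => C / δ * (r ^ n)⁻¹ * J x)
      (unitBall n) := (IntegrableOn.integrable_indicator hJi (measurableSet_layer δ)).integrableOn
  have hpt : ∀ᵐ x ∂volume.restrict (unitBall n),
      D.indicator (fun x => c * volDens (fderiv ℝ F x)) x -
        (layer n δ).indicator (fun x => C / δ * (r ^ n)⁻¹ * J x) x ≤
      g (x, F x) * ((n + 1) * volDens (fderiv ℝ F x)) +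
      mssForm (fderiv ℝ F x) (dhalf (fderiv ℝ F x) (x - x₀) (F x - F x₀))
        (fderiv ℝ (fun x => g (x, F x)) x) := by
    refine ae_restrict_of_ae ?_
    filter_upwards [hK.ae_differentiableAt] with x hx
    set q := dhalf (fderiv ℝ F x) (x - x₀) (F x - F x₀) with hq
    set V := volDens (fderiv ℝ F x) with hV
    have hV0 : 0 ≤ V := volDens_nonneg _
    have hpos : 0 < τ x + s ^ 2 := by have := hτ0 x; linarith
    set A := (τ x + s ^ 2) ^ (e - 1) with hA
    have hA0 : 0 ≤ A := Real.rpow_nonneg hpos.le _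
    have hAe : (τ x + s ^ 2) ^ e = A * (τ x + s ^ 2) := by
      rw [hA, Real.rpow_sub_one hpos.ne', div_mul_cancel₀ _ hpos.ne']
    have hfd : fderiv ℝ (fun x => g (x, F x)) x =
        cutoff δ (bdf x) • (e * A) • (2 : ℝ) • q +
          (τ x + s ^ 2) ^ e • deriv (cutoff δ) (bdf x) • fderiv ℝ bdf x := by
      have h := ((hasDerivAt_cutoff δ (bdf x)).comp_hasFDerivAt x (hasFDerivAt_bdf x)).mul
        (((hasFDerivAt_norm_sq_sub hx x₀ (F x₀)).add_const (s ^ 2)).rpow_const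
          (p := e) (Or.inl hpos.ne'))
      exact h.fderiv
    have hBqq := mssForm_dhalf_self_le (fderiv ℝ F x) (x - x₀) (F x - F x₀)
    set Bqq := mssForm (fderiv ℝ F x) q q with hBqqdef
    have hBqb : |mssForm (fderiv ℝ F x) q (fderiv ℝ bdf x)| ≤ Real.sqrt (τ x) * J x := by
      rw [hJdef, ← Real.sqrt_mul (hτ0 x)]
      exact Real.abs_le_sqrt (sq_mssForm_dhalf_le _ _ _ _)
    set Bqb := mssForm (fderiv ℝ F x) q (fderiv ℝ bdf x) with hBqbdef
    have hζ0 := cutoff_nonneg δ (bdf x)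
    set ζ := cutoff δ (bdf x) with hζ
    set ζ' := deriv (cutoff δ) (bdf x) with hζ'
    have hgx : g (x, F x) = ζ * (A * (τ x + s ^ 2)) := by rw [← hAe]
    rw [hfd, hgx]
    simp only [map_add, map_smul, smul_eq_mul]
    have h1 : D.indicator (fun x => c * volDens (fderiv ℝ F x)) x ≤
        (n + 1) * s ^ 2 * A * ζ * V := by
      by_cases hxD : x ∈ D
      · obtain ⟨hd1, hd2⟩ := hD x hxD
        rw [Set.indicator_of_mem hxD, hζ, cutoff_eq_one hδ hd1, mul_one, hc, ← mul_assoc]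
        gcongr
        exact Real.rpow_le_rpow_of_nonpos hpos (by linarith) he0
      · rw [Set.indicator_of_notMem hxD]
        positivity
    have h2 : |(τ x + s ^ 2) ^ e * (ζ' * Bqb)| ≤
        (layer n δ).indicator (fun x => C / δ * (r ^ n)⁻¹ * J x) x := by
      by_cases hxl : x ∈ layer n δ
      · rw [Set.indicator_of_mem hxl, abs_mul, abs_mul, abs_of_nonneg (Real.rpow_nonneg hpos.le _)]
        have hJ0 : 0 ≤ J x := Real.sqrt_nonneg _
        have h3 := rpow_mul_sqrt_le hr hS.le (hrx x hxl) n
        calc (τ x + s ^ 2) ^ e * (|ζ'| * |Bqb|) ≤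
              (τ x + s ^ 2) ^ e * (C / δ * (Real.sqrt (τ x) * J x)) := by
              gcongr
              exact hC _
          _ = C / δ * ((τ x + s ^ 2) ^ e * Real.sqrt (τ x)) * J x := by ring
          _ ≤ C / δ * (r ^ n)⁻¹ * J x := by gcongr
      · rw [Set.indicator_of_notMem hxl, hζ', deriv_cutoff_eq_zero hδ hxl]
        simp
    have h3 := neg_le_of_abs_le h2
    have h4 : (n + 1) * s ^ 2 * A * ζ * V ≤
        ζ * (A * (τ x + s ^ 2)) * ((n + 1) * V) + ζ * (e * A * (2 * Bqq)) := by
      have h5 : 0 ≤ ζ * A * (n + 1) * (V * τ x - Bqq) :=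
        mul_nonneg (by positivity) (sub_nonneg.mpr hBqq)
      rw [he]
      nlinarith
    linarith
  have hmono := integral_mono_ae (hVi'.sub hJi') hI hpt
  rw [hI0] at hmono
  have e1 := integral_sub hVi' hJi'
  simp only [Pi.sub_apply] at hmono e1
  rw [e1, setIntegral_indicator hDm, setIntegral_indicator (measurableSet_layer δ),
    Set.inter_eq_right.mpr hDb, Set.inter_eq_right.mpr hlay, integral_const_mul,
    integral_const_mul] at hmono
  have h6 : C / δ * (r ^ n)⁻¹ * ∫ x in layer n δ, J x ≤ C / δ * (r ^ n)⁻¹ * (Λ * δ) := by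
    gcongr
  have h7 : C / δ * (r ^ n)⁻¹ * (Λ * δ) = C * Λ * (r ^ n)⁻¹ := by field_simp
  linarith

end MonotonicityInequality

section Density
open Filter Topology Metric

variable {n m : ℕ}

lemma volDens_one_div {P : Eu n →L[ℝ] Eu m} (x₀ : Eu n) {r : ℝ} (hr : 0 < r) :
    volDens P * volume.real {x | ‖x - x₀‖ ^ 2 + ‖P (x - x₀)‖ ^ 2 < r ^ 2} =
      r ^ (n + 1) * volume.real (unitBall n) := by
  have h := congrArg ENNReal.toReal (volume_ellipsoid P x₀ hr)
  rwa [ENNReal.toReal_mul, ENNReal.toReal_mul, ENNReal.toReal_ofReal (volDens_nonneg _),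
    ENNReal.toReal_ofReal (by positivity)] at h

lemma locallyIntegrable_volDens {F : Eu n → Eu m} {K : NNReal} (hK : LipschitzWith K F) :
    LocallyIntegrable (fun x => volDens (fderiv ℝ F x)) := by
  obtain ⟨M, hM⟩ := (isCompact_closedBall (0 : Eu n →L[ℝ] Eu m) K).exists_bound_of_continuousOn
    continuous_volDens.continuousOn
  refine (locallyIntegrable_const M).mono
    (continuous_volDens.measurable.comp (measurable_fderiv ℝ F)).aestronglyMeasurable
    (Eventually.of_forall fun x => ?_)
  refine (hM _ ?_).trans (Real.le_norm_self _)
  simpa using norm_fderiv_le_of_lipschitz ℝ hK (x₀ := x)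

/-- At almost every point the area of the graph inside a small ball is at least a definite
fraction of that of a flat disc. -/
lemma exists_area_lower_bound {F : Eu n → Eu m} {K : NNReal} (hK : LipschitzWith K F)
    {W : Set (Eu n)} (hW : IsOpen W) (hne : W.Nonempty) :
    ∃ x₀ ∈ W, ∃ s₀ > 0, ∀ s, 0 < s → s < s₀ → ∃ D, MeasurableSet D ∧ D ⊆ ball x₀ s ∧
      (∀ x ∈ D, ‖x - x₀‖ ^ 2 + ‖F x - F x₀‖ ^ 2 < s ^ 2) ∧
      (s / 2) ^ (n + 1) * volume.real (unitBall n) / 2 ≤ ∫ x in D, volDens (fderiv ℝ F x) := by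
  have hloc := locallyIntegrable_volDens hK
  have hae := (IsUnifLocDoublingMeasure.ae_tendsto_average_norm_sub volume hloc 1).and
    hK.ae_differentiableAt
  obtain ⟨x₀, hx₀W, hleb, hdiff⟩ : ∃ x₀ ∈ W, _ := by
    by_contra hcon
    push Not at hcon
    exact (hW.measure_pos volume hne).ne' (measure_mono_null (fun x hx => hcon x hx) hae)
  set v : Eu n → ℝ := fun x => volDens (fderiv ℝ F x) with hv
  set P := fderiv ℝ F x₀ with hP
  have hω : 0 < volume.real (unitBall n) :=
    ENNReal.toReal_pos (measure_ball_pos volume _ one_pos).ne' measure_ball_lt_top.ne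
  have hav := hleb (l := 𝓝[>] (0 : ℝ)) (fun _ => x₀) (fun s => s) tendsto_id
    (eventually_mem_nhdsWithin.mono fun s hs => mem_closedBall_self (by
      rw [one_mul]; exact le_of_lt hs))
  have hε : (0 : ℝ) < 2⁻¹ ^ (n + 1) / 2 := by positivity
  obtain ⟨s₁, hs₁, hsub⟩ := mem_nhdsGT_iff_exists_Ioo_subset.mp (hav.eventually_lt_const hε)
  have hlit := hdiff.hasFDerivAt.isLittleO.def one_pos
  obtain ⟨s₂, hs₂, hlit'⟩ := Metric.eventually_nhds_iff_ball.mp hlit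
  refine ⟨x₀, hx₀W, min s₁ s₂, lt_min hs₁ hs₂, fun s hs hs' => ?_⟩
  have hss₁ := hs'.trans_le (min_le_left _ _)
  have hss₂ := hs'.trans_le (min_le_right _ _)
  set D : Set (Eu n) := {x | ‖x - x₀‖ ^ 2 + ‖P (x - x₀)‖ ^ 2 < (s / 2) ^ 2} with hDdef
  have hDo : IsOpen D := isOpen_lt (by fun_prop) continuous_const
  have hDs : ∀ x ∈ D, ‖x - x₀‖ < s / 2 := fun x hx => by
    have hx' : ‖x - x₀‖ ^ 2 + ‖P (x - x₀)‖ ^ 2 < (s / 2) ^ 2 := hx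
    exact lt_of_pow_lt_pow_left₀ 2 (by positivity)
      (by have := sq_nonneg ‖P (x - x₀)‖; linarith)
  have hDball : D ⊆ ball x₀ s := fun x hx => by
    rw [mem_ball_iff_norm]; linarith [hDs x hx]
  refine ⟨D, hDo.measurableSet, hDball, fun x hx => ?_, ?_⟩
  · have h1 := hlit' x (ball_subset_ball hss₂.le (hDball hx))
    rw [one_mul] at h1
    have h2 : ‖F x - F x₀‖ ≤ ‖P (x - x₀)‖ + ‖x - x₀‖ := by
      calc ‖F x - F x₀‖ = ‖P (x - x₀) + (F x - F x₀ - P (x - x₀))‖ := by congr 1; abel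
        _ ≤ _ := (norm_add_le _ _).trans (by gcongr)
    have hx' : ‖x - x₀‖ ^ 2 + ‖P (x - x₀)‖ ^ 2 < (s / 2) ^ 2 := hx
    have h3 : ‖F x - F x₀‖ ^ 2 ≤ (‖P (x - x₀)‖ + ‖x - x₀‖) ^ 2 := by gcongr
    nlinarith [sq_nonneg (‖P (x - x₀)‖ - ‖x - x₀‖), sq_nonneg ‖P (x - x₀)‖]
  · have hvi : IntegrableOn v (closedBall x₀ s) :=
      hloc.integrableOn_isCompact (isCompact_closedBall _ _)
    have hDcb := hDball.trans ball_subset_closedBall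
    have hfin : volume (closedBall x₀ s) ≠ ⊤ := measure_closedBall_lt_top.ne
    have hdi : IntegrableOn (fun x => ‖v x - v x₀‖) (closedBall x₀ s) :=
      (hvi.sub (integrableOn_const hfin)).norm
    have h1 := hsub ⟨hs, hss₁⟩
    change ⨍ y in closedBall x₀ s, ‖v y - v x₀‖ < _ at h1
    have hvol : volume.real (closedBall x₀ s) = s ^ (n + 1) * volume.real (unitBall n) := by
      rw [measureReal_def, Measure.addHaar_closedBall _ _ hs.le, ENNReal.toReal_mul,
        ENNReal.toReal_ofReal (by positivity), finrank_euclideanSpace_fin, measureReal_def]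
    rw [setAverage_eq, smul_eq_mul, hvol, inv_mul_lt_iff₀ (by positivity)] at h1
    have h2 : ∫ x in D, ‖v x - v x₀‖ ≤ ∫ x in closedBall x₀ s, ‖v x - v x₀‖ :=
      setIntegral_mono_set hdi (Eventually.of_forall fun _ => norm_nonneg _)
        (LE.le.eventuallyLE hDcb)
    have hfinD : volume D ≠ ⊤ := ((measure_mono hDcb).trans_lt hfin.lt_top).ne
    have hci : IntegrableOn (fun _ => v x₀) D := integrableOn_const hfinD
    have h3 : ∫ x in D, (v x₀ - ‖v x - v x₀‖) ≤ ∫ x in D, v x := by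
      refine setIntegral_mono_on (hci.sub (hdi.mono_set hDcb)) (hvi.mono_set hDcb)
        hDo.measurableSet fun x _ => ?_
      have := neg_abs_le (v x - v x₀)
      rw [Real.norm_eq_abs]
      linarith
    rw [integral_sub hci (hdi.mono_set hDcb), setIntegral_const, smul_eq_mul, mul_comm,
      show v x₀ * volume.real D = _ from volDens_one_div x₀ (half_pos hs)] at h3
    have h4 : s ^ (n + 1) * volume.real (unitBall n) * (2⁻¹ ^ (n + 1) / 2) =
        (s / 2) ^ (n + 1) * volume.real (unitBall n) / 2 := by
      rw [div_eq_mul_inv s, mul_pow]; ring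
    linarith

end Density

section Comparison
open Filter Topology Metric

variable {n m : ℕ}

lemma sq_mul_rpow_mul_pow {s : ℝ} (hs : 0 < s) (n : ℕ) :
    s ^ 2 * (2 * s ^ 2) ^ (-(((n : ℝ) + 1) / 2) - 1) * s ^ (n + 1) =
      2 ^ (-(((n : ℝ) + 1) / 2) - 1) := by
  have h1 : (s ^ 2) ^ (-(((n : ℝ) + 1) / 2) - 1) * (s ^ 2 * s ^ (n + 1)) = 1 := by
    rw [← pow_add, ← Real.rpow_natCast, ← Real.rpow_natCast, ← Real.rpow_mul hs.le,
      ← Real.rpow_add hs]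
    convert Real.rpow_zero s using 2
    push_cast
    ring
  rw [Real.mul_rpow zero_le_two (by positivity)]
  linear_combination (2 : ℝ) ^ (-(((n : ℝ) + 1) / 2) - 1) * h1

/-- A solution taking a value far from its boundary values forces a lower bound on the size of
the boundary data. -/
lemma IsWeakSol.lower_bound_le {F H : Eu n → Eu m} (hF : IsWeakSol F)
    (hH : ContDiff ℝ 2 H) (hbd : ∀ x, ‖x‖ = 1 → F x = H x) {l : ℕ} {A : ℝ}
    (hrank : ∀ x, ‖x‖ = 1 →
      Module.finrank ℝ (LinearMap.range (fderiv ℝ H x : Eu n →ₗ[ℝ] Eu m)) ≤ l)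
    (hA : ∀ x, ‖x‖ = 1 → ‖fderiv ℝ H x‖ ≤ A) {C : ℝ} (hC0 : 0 ≤ C)
    (hC : ∀ δ > 0, ∀ t, |deriv (cutoff δ) t| ≤ C / δ) {T r : ℝ} (hT : 0 < T) (hr : 0 < r)
    {W : Set (Eu n)} (hW : IsOpen W) (hne : W.Nonempty) (hWb : W ⊆ unitBall n)
    (hWr : ∀ x ∈ W, ∀ z, ‖z‖ = 1 → 2 * r ≤ ‖F z - F x‖) :
    (n + 1) * 2 ^ (-(((n : ℝ) + 1) / 2) - 1) * 2⁻¹ ^ (n + 1) * volume.real (unitBall n) / 2 ≤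
      C * ((2 * T)⁻¹ * (((n + 1) * 4 * (1 + (n + 1) * A ^ 2) ^ l + 1) *
        (2 * (n + 1) * volume.real (unitBall n)) + 1) +
        T / 2 * (2 * (n + 1) * volume.real (unitBall n))) * (r ^ n)⁻¹ := by
  obtain ⟨K, hK⟩ := hF.exists_lip
  obtain ⟨x₀, hx₀, s₀, hs₀, hs⟩ := exists_area_lower_bound hK hW hne
  have hx₀1 := mem_ball_zero_iff.mp (hWb hx₀)
  set s : ℝ := min s₀ (1 - ‖x₀‖) / 2 with hsdef
  have hspos : 0 < s := half_pos (lt_min hs₀ (by linarith))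
  have hs1 : s < s₀ := by
    have := min_le_left s₀ (1 - ‖x₀‖)
    linarith
  have hs2 : s ≤ (1 - ‖x₀‖) / 2 := by
    have := min_le_right s₀ (1 - ‖x₀‖)
    linarith
  obtain ⟨D, hDm, hDs, hDτ, hDv⟩ := hs s hspos hs1
  obtain ⟨δ₀, hδ₀, hslice⟩ := hF.exists_sliceDens_layer_le hH hbd hrank hA
  have hρ : 0 < (1 - ‖x₀‖) / 2 := by linarith
  obtain ⟨δ, hδ, hδ1, hδ2, hδ3, hδ4⟩ : ∃ δ : ℝ, 0 < δ ∧ δ < δ₀ ∧ δ ≤ 1 / 2 ∧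
      2 * δ ≤ (1 - ‖x₀‖) / 2 ∧ K * (2 * δ) ≤ r := by
    have h1 : ∀ᶠ δ : ℝ in 𝓝[>] 0, 0 < δ := eventually_mem_nhdsWithin
    have h2 : ∀ᶠ δ : ℝ in 𝓝[>] 0, δ < δ₀ :=
      nhdsWithin_le_nhds (eventually_lt_nhds hδ₀)
    have h3 : ∀ᶠ δ : ℝ in 𝓝[>] 0, δ < 1 / 2 :=
      nhdsWithin_le_nhds (eventually_lt_nhds (by norm_num))
    have h4 : ∀ᶠ δ : ℝ in 𝓝[>] 0, 2 * δ < (1 - ‖x₀‖) / 2 :=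
      nhdsWithin_le_nhds (((continuous_const_mul (2 : ℝ)).tendsto' 0 0 (mul_zero _)).eventually
        (eventually_lt_nhds hρ))
    have h5 : ∀ᶠ δ : ℝ in 𝓝[>] 0, K * (2 * δ) < r :=
      nhdsWithin_le_nhds ((((continuous_const_mul (2 : ℝ)).const_mul (K : ℝ)).tendsto' 0 0
        (by simp)).eventually (eventually_lt_nhds hr))
    obtain ⟨δ, a1, a2, a3, a4, a5⟩ :=
      (h1.and (h2.and (h3.and (h4.and h5)))).exists
    exact ⟨δ, a1, a2, a3.le, a4.le, a5.le⟩
  have hDx : ∀ x ∈ D, x ∈ unitBall n ∧ 2 * δ ≤ bdf x := fun x hx => by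
    have h1 := mem_ball_iff_norm.mp (hDs hx)
    have h2 : ‖x‖ ≤ ‖x₀‖ + ‖x - x₀‖ := norm_le_norm_add_norm_sub' x x₀
    have h3 : x ∈ unitBall n := by rw [mem_ball_zero_iff]; linarith
    exact ⟨h3, by have := one_sub_norm_le_bdf h3; linarith⟩
  have hlayr : ∀ x ∈ layer n δ, r ^ 2 ≤ ‖x - x₀‖ ^ 2 + ‖F x - F x₀‖ ^ 2 := fun x hx => by
    have hxb := layer_subset hδ hx
    obtain ⟨z, hz, hxz⟩ := exists_norm_eq_one_dist_le hxb
    have h1 := hWr x₀ hx₀ z hz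
    have h2 : ‖F x - F z‖ ≤ r := by
      rw [← dist_eq_norm]
      refine (hK.dist_le_mul x z).trans (le_trans ?_ hδ4)
      have := one_sub_norm_le_bdf hxb
      have := hx.2
      gcongr
      linarith
    have h3 : ‖F z - F x₀‖ ≤ ‖F x - F x₀‖ + ‖F x - F z‖ := by
      rw [show F z - F x₀ = (F x - F x₀) - (F x - F z) by abel]
      exact norm_sub_le _ _
    have h4 : r ≤ ‖F x - F x₀‖ := by linarith
    have h5 : r ^ 2 ≤ ‖F x - F x₀‖ ^ 2 := by gcongr
    have := sq_nonneg ‖x - x₀‖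
    linarith
  have hJ := setIntegral_sqrt_sliceDens_le hK (by positivity) hT hδ hδ2 (hslice δ hδ hδ1)
  have hfin := hF.area_le_flux x₀ hspos hr hδ (hδ2.trans (by norm_num)) hC0 (hC δ hδ) hJ hlayr
    hDm (fun x hx => (hDx x hx).1) fun x hx => ⟨(hDx x hx).2, hDτ x hx⟩
  refine le_trans (le_of_eq ?_) ((mul_le_mul_of_nonneg_left hDv (by positivity)).trans hfin)
  rw [← sq_mul_rpow_mul_pow hspos n, div_eq_mul_inv s, mul_pow]
  ring

end Comparison

section Topological
open Filter Topology Metric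

variable {n m : ℕ}

/-- If `η : Sⁿ → N` is not null-homotopic, no extension to the ball stays in a neighbourhood
retracting onto `N`. -/
lemma exists_notMem_of_not_nullHomotopic {η G : Eu n → Eu m} {U : Set (Eu m)} {ρ : Eu m → Eu m}
    (hρcont : ContinuousOn ρ U)
    (hρmaps : ∀ y ∈ U, ρ y ∈ η '' sphere (0 : Eu n) 1)
    (hρid : ∀ y ∈ η '' sphere (0 : Eu n) 1, ρ y = y)
    (hnotnull : ∀ g : C(↥(sphere (0 : Eu n) 1), ↥(η '' sphere (0 : Eu n) 1)),
      (∀ x, (g x : Eu m) = η x) → ∀ y, ¬ g.Homotopic (ContinuousMap.const _ y))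
    (hG : Continuous G) (hGη : ∀ x ∈ sphere (0 : Eu n) 1, G x = η x) :
    ∃ x ∈ closedBall (0 : Eu n) 1, G x ∉ U := by
  by_contra! hcon
  let g : C(↥(sphere (0 : Eu n) 1), ↥(η '' sphere (0 : Eu n) 1)) :=
    ⟨fun x => ⟨η x, x, x.2, rfl⟩, by
      refine Continuous.subtype_mk ?_ _
      have h : (fun x : sphere (0 : Eu n) 1 => η x) = fun x : sphere (0 : Eu n) 1 => G x := by
        funext x; exact (hGη x x.2).symm
      rw [h]
      exact hG.comp continuous_subtype_val⟩
  have hmem : ∀ z : unitInterval × sphere (0 : Eu n) 1,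
      G ((1 - (z.1 : ℝ)) • (z.2 : Eu n)) ∈ U := fun z => by
    refine hcon _ ?_
    have h1 := z.1.2.1
    have h2 := z.1.2.2
    rw [mem_closedBall_zero_iff, norm_smul, mem_sphere_zero_iff_norm.mp z.2.2, mul_one,
      Real.norm_of_nonneg (by linarith)]
    linarith
  have h0 : G 0 ∈ U := hcon 0 (by simp)
  refine hnotnull g (fun x => rfl) ⟨ρ (G 0), hρmaps _ h0⟩ ⟨⟨⟨fun z =>
    ⟨ρ (G ((1 - (z.1 : ℝ)) • (z.2 : Eu n))), hρmaps _ (hmem z)⟩, ?_⟩, fun x => ?_, fun x => ?_⟩⟩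
  · refine Continuous.subtype_mk (hρcont.comp_continuous (hG.comp ?_) hmem) _
    fun_prop
  · refine Subtype.ext ?_
    change ρ (G ((1 - ((0 : unitInterval) : ℝ)) • (x : Eu n))) = η x
    rw [Set.Icc.coe_zero, sub_zero, one_smul, hGη x x.2]
    exact hρid _ ⟨x, x.2, rfl⟩
  · refine Subtype.ext ?_
    change ρ (G ((1 - ((1 : unitInterval) : ℝ)) • (x : Eu n))) = ρ (G 0)
    rw [Set.Icc.coe_one, sub_self, zero_smul]

end Topological

section Extension
open Filter Topology Metric
open scoped Manifold ContDiff

variable {n m : ℕ}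

/-- A `C²` map near a compact set agrees near that set with a globally `C²` map. -/
lemma exists_contDiff_eventuallyEq {η : Eu n → Eu m} {V S : Set (Eu n)} (hV : IsOpen V)
    (hS : IsCompact S) (hSV : S ⊆ V) (hη : ContDiffOn ℝ 2 η V) :
    ∃ H : Eu n → Eu m, ContDiff ℝ 2 H ∧ ∀ x ∈ S, H =ᶠ[𝓝 x] η := by
  obtain ⟨τ, hτ, hτV⟩ := hS.exists_cthickening_subset_open hV hSV
  obtain ⟨f, hf1, hf0, -⟩ := exists_contMDiffMap_one_nhds_of_subset_interior 𝓘(ℝ, Eu n) (n := 2)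
    hS.isClosed (t := cthickening τ S)
    ((self_subset_thickening hτ S).trans (thickening_subset_interior_cthickening τ S))
  have hfc : ContDiff ℝ 2 f := contMDiff_iff_contDiff.mp f.contMDiff
  refine ⟨fun x => f x • η x, contDiff_iff_contDiffAt.mpr fun x => ?_, fun x hx => ?_⟩
  · by_cases hx : x ∈ V
    · exact hfc.contDiffAt.smul (hη.contDiffAt (hV.mem_nhds hx))
    · have hx' : x ∉ cthickening τ S := fun h => hx (hτV h)
      have h0 : (fun x => f x • η x) =ᶠ[𝓝 x] fun _ => 0 := by
        filter_upwards [isClosed_cthickening.isOpen_compl.mem_nhds hx'] with y hy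
        rw [hf0 y hy, zero_smul]
      exact contDiffAt_const.congr_of_eventuallyEq h0
  · filter_upwards [(eventually_nhdsSet_iff_forall.mp hf1) x hx] with y hy
    rw [hy, one_smul]

end Extension

section Scaling

lemma exists_flux_le (n : ℕ) {l : ℕ} (hln : l < n) {ω A ε C : ℝ} (hω : 0 ≤ ω) (hε : 0 < ε)
    (hC : 0 ≤ C) : ∃ B, ∀ R : ℝ, 1 ≤ R →
      C * ((2 * R ^ l)⁻¹ * (((n + 1) * 4 * (1 + (n + 1) * (R * A) ^ 2) ^ l + 1) *
        (2 * (n + 1) * ω) + 1) + R ^ l / 2 * (2 * (n + 1) * ω)) * ((R * ε) ^ n)⁻¹ ≤ B / R := by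
  set a : ℝ := (n + 1) * 4 * (1 + (n + 1) * A ^ 2) ^ l with ha
  set c : ℝ := 2 * (n + 1) * ω with hc
  have ha0 : 0 ≤ a := by positivity
  have hc0 : 0 ≤ c := by positivity
  set b : ℝ := ((a + 1) * c + 1) / 2 + c / 2 with hb
  have hb0 : 0 ≤ b := by positivity
  refine ⟨C * b * (ε ^ n)⁻¹, fun R hR => ?_⟩
  have hR0 : 0 < R := by linarith
  have h1 : 1 ≤ R ^ l := one_le_pow₀ hR
  have h2 : 1 ≤ (R ^ l) ^ 2 := one_le_pow₀ h1
  have h3 : (n + 1) * 4 * (1 + (n + 1) * (R * A) ^ 2) ^ l ≤ a * (R ^ l) ^ 2 := by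
    have h4 : 1 + (n + 1) * (R * A) ^ 2 ≤ R ^ 2 * (1 + (n + 1) * A ^ 2) := by
      have := one_le_pow₀ (n := 2) hR
      nlinarith
    calc _ ≤ ((n : ℝ) + 1) * 4 * (R ^ 2 * (1 + (n + 1) * A ^ 2)) ^ l := by gcongr
      _ = _ := by rw [mul_pow, ha]; ring
  have h5 : (2 * R ^ l)⁻¹ * (((n + 1) * 4 * (1 + (n + 1) * (R * A) ^ 2) ^ l + 1) * c + 1) +
      R ^ l / 2 * c ≤ b * R ^ l := by
    calc _ ≤ (2 * R ^ l)⁻¹ * ((a * (R ^ l) ^ 2 + (R ^ l) ^ 2) * c + (R ^ l) ^ 2) +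
        R ^ l / 2 * c := by gcongr
      _ = _ := by rw [hb]; field_simp
  have h6 : R ^ l * (R ^ n)⁻¹ ≤ R⁻¹ := by
    rw [← div_eq_mul_inv, div_le_iff₀ (by positivity), inv_mul_eq_div, le_div_iff₀ hR0,
      ← pow_succ]
    exact pow_le_pow_right₀ hR hln
  calc _ ≤ C * (b * R ^ l) * ((R * ε) ^ n)⁻¹ := by gcongr
    _ = C * b * (ε ^ n)⁻¹ * (R ^ l * (R ^ n)⁻¹) := by rw [mul_pow, mul_inv]; ring
    _ ≤ C * b * (ε ^ n)⁻¹ * R⁻¹ := by gcongr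
    _ = _ := by rw [div_eq_mul_inv]

end Scaling

/-- Non-existence of solutions to the Dirichlet problem for the minimal surface system
for strongly rescaled boundary data `R·η`, when `η` has image of lower dimension admitting
a neighborhood retraction and `η : Sⁿ → N` is not null-homotopic. -/
theorem nonexistence_retract (n m l : ℕ) (hn : 0 < n) (hm : 0 < m) (hl : 0 < l) (hln : l < n)
    (η : EuclideanSpace ℝ (Fin (n+1)) → EuclideanSpace ℝ (Fin (m+1)))
    (V : Set (EuclideanSpace ℝ (Fin (n+1)))) (hVopen : IsOpen V)
    (hSV : Metric.sphere (0 : EuclideanSpace ℝ (Fin (n+1))) 1 ⊆ V)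
    (hηC2 : ContDiffOn ℝ 2 η V)
    -- (i) rank of dη_x is at most l on the sphere
    (hrank : ∀ x ∈ Metric.sphere (0 : EuclideanSpace ℝ (Fin (n+1))) 1,
      Module.finrank ℝ
        (LinearMap.range ((fderiv ℝ η x : EuclideanSpace ℝ (Fin (n+1)) →L[ℝ]
          EuclideanSpace ℝ (Fin (m+1))) :
            EuclideanSpace ℝ (Fin (n+1)) →ₗ[ℝ] EuclideanSpace ℝ (Fin (m+1)))) ≤ l)
    -- (ii) the image N = η(Sⁿ) admits a continuous retraction of an ε₀-neighborhood
    (ε₀ : ℝ) (hε₀ : 0 < ε₀)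
    (ρ : EuclideanSpace ℝ (Fin (m+1)) → EuclideanSpace ℝ (Fin (m+1)))
    (hρcont : ContinuousOn ρ
      (Metric.thickening ε₀ (η '' Metric.sphere (0 : EuclideanSpace ℝ (Fin (n+1))) 1)))
    (hρmaps : ∀ y ∈ Metric.thickening ε₀
        (η '' Metric.sphere (0 : EuclideanSpace ℝ (Fin (n+1))) 1),
      ρ y ∈ η '' Metric.sphere (0 : EuclideanSpace ℝ (Fin (n+1))) 1)
    (hρid : ∀ y ∈ η '' Metric.sphere (0 : EuclideanSpace ℝ (Fin (n+1))) 1, ρ y = y)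
    -- (iii) η|_{Sⁿ} : Sⁿ → N is not null-homotopic
    (hnotnull : ∀ g : C(↥(Metric.sphere (0 : EuclideanSpace ℝ (Fin (n+1))) 1),
        ↥(η '' Metric.sphere (0 : EuclideanSpace ℝ (Fin (n+1))) 1)),
      (∀ x, (g x : EuclideanSpace ℝ (Fin (m+1))) = η x) →
      ∀ y, ¬ g.Homotopic (ContinuousMap.const _ y)) :
    ∃ Rη > (0:ℝ), ∀ R ≥ Rη,
      ¬ ∃ F, IsMSSolution n m (Metric.ball (0 : EuclideanSpace ℝ (Fin (n+1))) 1)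
        (fun x => R • η x) F := by
  classical
  obtain ⟨H₀, hH₀, hH₀η⟩ :=
    exists_contDiff_eventuallyEq hVopen (isCompact_sphere (0 : Eu n) 1) hSV hηC2
  have hval : ∀ x ∈ Metric.sphere (0 : Eu n) 1, H₀ x = η x := fun x hx => (hH₀η x hx).eq_of_nhds
  obtain ⟨A, hA⟩ := (isCompact_sphere (0 : Eu n) 1).exists_bound_of_continuousOn
    (hH₀.continuous_fderiv (by norm_num)).continuousOn
  obtain ⟨C, hC0, hC⟩ := exists_abs_deriv_cutoff_le
  have hω : 0 < volume.real (unitBall n) :=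
    ENNReal.toReal_pos (Metric.measure_ball_pos _ _ one_pos).ne' measure_ball_lt_top.ne
  obtain ⟨B, hB⟩ := exists_flux_le n hln (A := A) hω.le (show 0 < ε₀ / 4 by positivity) hC0
  obtain ⟨κ, hκ⟩ : ∃ κ : ℝ, κ = ((n : ℝ) + 1) * 2 ^ (-(((n : ℝ) + 1) / 2) - 1) * 2⁻¹ ^ (n + 1) *
    volume.real (unitBall n) / 2 := ⟨_, rfl⟩
  have hκ0 : 0 < κ := by rw [hκ]; positivity
  refine ⟨max 1 (B / κ + 1), lt_max_of_lt_left one_pos, fun R hR => ?_⟩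
  rintro ⟨F₀, hF₀⟩
  have hR1 : 1 ≤ R := (le_max_left _ _).trans hR
  have hR0 : 0 < R := by linarith
  obtain ⟨F, hF, hFη⟩ := hF₀.exists_isWeakSol
  obtain ⟨K, hK⟩ := hF.exists_lip
  set N : Set (Eu m) := η '' Metric.sphere (0 : Eu n) 1 with hN
  have hGη : ∀ x ∈ Metric.sphere (0 : Eu n) 1, R⁻¹ • F x = η x := fun x hx => by
    rw [hFη x (mem_sphere_zero_iff_norm.mp hx), inv_smul_smul₀ hR0.ne']
  have hGc : Continuous fun x => R⁻¹ • F x := (continuous_const_smul R⁻¹).comp hK.continuous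
  obtain ⟨x₁, hx₁, hx₁N⟩ :=
    exists_notMem_of_not_nullHomotopic hρcont hρmaps hρid hnotnull hGc hGη
  have hx₁S : x₁ ∉ Metric.sphere (0 : Eu n) 1 := fun h =>
    hx₁N (Metric.self_subset_thickening hε₀ _ ⟨x₁, h, (hGη x₁ h).symm⟩)
  have hx₁b : x₁ ∈ unitBall n := by
    rw [Metric.mem_ball]
    exact lt_of_le_of_ne (Metric.mem_closedBall.mp hx₁) hx₁S
  have hNne : N.Nonempty :=
    (NormedSpace.sphere_nonempty.mpr zero_le_one : (Metric.sphere (0 : Eu n) 1).Nonempty).image η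
  have hdist : ε₀ ≤ Metric.infDist (R⁻¹ • F x₁) N := by
    by_contra! h
    exact hx₁N ((Metric.mem_thickening_iff_infDist_lt hNne).mpr h)
  have hfd : ∀ x, fderiv ℝ (fun x => R • H₀ x) x = R • fderiv ℝ H₀ x := fun x =>
    fderiv_const_smul ((hH₀.differentiable (by norm_num)) x) R
  have key := hF.lower_bound_le (H := fun x => R • H₀ x) (hH₀.const_smul R)
    (fun x hx => by rw [hFη x hx, hval x (mem_sphere_zero_iff_norm.mpr hx)]) (l := l) (A := R * A)
    (fun x hx => by
      have hx' := mem_sphere_zero_iff_norm.mpr hx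
      refine le_trans (Submodule.finrank_mono ?_) (hrank x hx')
      rw [hfd, (hH₀η x hx').fderiv_eq]
      rintro _ ⟨v, rfl⟩
      exact ⟨R • v, by simp⟩)
    (fun x hx => by
      rw [hfd, norm_smul, Real.norm_of_nonneg hR0.le]
      exact mul_le_mul_of_nonneg_left (hA x (mem_sphere_zero_iff_norm.mpr hx)) hR0.le)
    hC0 hC (T := R ^ l) (r := R * (ε₀ / 4)) (by positivity) (by positivity)
    (W := unitBall n ∩ {x | ε₀ / 2 < Metric.infDist (R⁻¹ • F x) N})
    (Metric.isOpen_ball.inter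
      (isOpen_lt continuous_const ((Metric.continuous_infDist_pt N).comp hGc)))
    ⟨x₁, hx₁b, by change ε₀ / 2 < _; linarith⟩ Set.inter_subset_left
    (fun x hx z hz => by
      have hz' := mem_sphere_zero_iff_norm.mpr hz
      have h1 : Metric.infDist (R⁻¹ • F x) N ≤ dist (R⁻¹ • F x) (R⁻¹ • F z) :=
        Metric.infDist_le_dist_of_mem ⟨z, hz', (hGη z hz').symm⟩
      rw [dist_comm, dist_eq_norm, ← smul_sub, norm_smul, Real.norm_of_nonneg (by positivity),
        inv_mul_eq_div, le_div_iff₀ hR0] at h1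
      have h2 : ε₀ / 2 < Metric.infDist (R⁻¹ • F x) N := hx.2
      nlinarith)
  have hle : κ ≤ B / R := hκ ▸ key.trans (hB R hR1)
  have hlt : B / κ + 1 ≤ R := (le_max_right _ _).trans hR
  rw [le_div_iff₀ hR0] at hle
  have h3 : κ * (B / κ + 1) ≤ κ * R := by gcongr
  rw [mul_add, mul_div_cancel₀ _ hκ0.ne'] at h3
  linarith
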